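/- arXiv:2009.14037 — 2 statements merged into one kernel-verified Lean document; each statement's English description precedes it below -/
import Mathlib

section
/- Let n ≥ 1 and let m be a positive integer. Then, as an identity of rational functions in ℚ(x_1,…,x_n), the Schur polynomial s_{(m^{n−1})} in the 2n variables (x_1, x_1^{−1}, …, x_n, x_n^{−1}) equals the sum of the symplectic characters sp_λ(x_1,…,x_n) over all λ ∈ Odd′((m^n)) if n is even, and over all λ ∈ Even′((m^n)) if n is odd. -/
open Matrix BigOperators
open scoped Classical

noncomputable section

/-- The field `ℚ(t_1, …, t_n)` of rational functions in `n` indeterminates over `ℚ`. -/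
abbrev FF (n : ℕ) : Type := FractionRing (MvPolynomial (Fin n) ℚ)

/-- The `i`-th indeterminate, viewed as an element of `FF n`. -/
def gen (n : ℕ) (i : Fin n) : FF n :=
  algebraMap (MvPolynomial (Fin n) ℚ) (FF n) (MvPolynomial.X i)

variable {F : Type*} [Field F]

/-- Symplectic character `sp_λ(z_1, …, z_N)` for an integer weight `μ`. -/
def spP {N : ℕ} (z : Fin N → F) (μ : Fin N → ℤ) : F :=
  Matrix.det (Matrix.of fun i j : Fin N =>
      z j ^ (μ i + (N : ℤ) - (i : ℕ)) - z j ^ (-(μ i + (N : ℤ) - (i : ℕ)))) /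
  Matrix.det (Matrix.of fun i j : Fin N =>
      z j ^ ((N : ℤ) - (i : ℕ)) - z j ^ (-((N : ℤ) - (i : ℕ))))

/-- The matrix `Ā_λ` of the bialternant formula for the intermediate symplectic character
`sp^{(k, N-k)}` with integer weight `μ`. -/
def interMatP {N : ℕ} (k : ℕ) (z : Fin N → F) (μ : Fin N → ℤ) : Matrix (Fin N) (Fin N) F :=
  Matrix.of fun i j : Fin N =>
    if (j : ℕ) < k then
      z j ^ (μ i + (k : ℤ) - (i : ℕ)) /
          ∏ l ∈ Finset.univ.filter (fun l : Fin N => k ≤ (l : ℕ)), (1 - (z j)⁻¹ * z l) -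
        z j ^ (-(μ i + (k : ℤ) - (i : ℕ))) /
          ∏ l ∈ Finset.univ.filter (fun l : Fin N => k ≤ (l : ℕ)), (1 - z j * z l)
    else z j ^ (μ i + (N : ℤ) - 1 - (i : ℕ))

/-- Intermediate symplectic character `sp^{(k, N-k)}_μ(z_1, …, z_k | z_{k+1}, …, z_N)`
for an integer weight `μ`. -/
def spInterP {N : ℕ} (k : ℕ) (z : Fin N → F) (μ : Fin N → ℤ) : F :=
  (interMatP k z μ).det / (interMatP k z fun _ => 0).det

/-- Schur function `s_μ(z_1, …, z_N)` as a ratio of alternants (bialternant formula). -/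
def schurP {N : ℕ} (z : Fin N → F) (μ : Fin N → ℤ) : F :=
  Matrix.det (Matrix.of fun i j : Fin N => z j ^ (μ i + (N : ℤ) - 1 - (i : ℕ))) /
  Matrix.det (Matrix.of fun i j : Fin N => z j ^ ((N : ℤ) - 1 - (i : ℕ)))

/-- The vector with entries `y ^ k * z ^ (R - 1 - k) * q t`, a point of the Veronese-type family
attached to the homogeneous coordinate `(y : z)` and the vector `q`. -/
def colVec {K : Type*} [Field K] (R : ℕ) (y z : K) (q : Fin 4 → K) : Fin R × Fin 4 → K :=
  fun p => y ^ (p.1 : ℕ) * z ^ (R - 1 - (p.1 : ℕ)) * q p.2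

/-- The determinant of a family of vectors, with respect to an identification of the index set
of the family with the index set of the coordinates. -/
def famDet {K : Type*} [Field K] {C ρ : Type*} [Fintype C] [DecidableEq C]
    (e : C ≃ ρ) (f : C → ρ → K) : K :=
  Matrix.det (Matrix.of fun c c' => f c (e c'))

section FamDet

variable {K : Type*} [Field K] {C C' ρ : Type*} [Fintype C] [DecidableEq C]
  [Fintype C'] [DecidableEq C']

lemma famDet_perm (e : C ≃ ρ) (τ : Equiv.Perm C) (f : C → ρ → K) :
    famDet e (fun c => f (τ c)) = ((Equiv.Perm.sign τ : ℤ) : K) * famDet e f := by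
  unfold famDet
  rw [← Matrix.det_permute]
  rfl

lemma exists_famDet_eq (e : C ≃ ρ) (e' : C' ≃ ρ) (σ : C' ≃ C) :
    ∃ u : ℤˣ, ∀ f : C → ρ → K,
      famDet e f = ((u : ℤ) : K) * famDet e' (fun c => f (σ c)) := by
  refine ⟨Equiv.Perm.sign ((σ.trans e).trans e'.symm), fun f => ?_⟩
  unfold famDet
  rw [← Matrix.det_permute', ← Matrix.det_submatrix_equiv_self σ]
  congr 1
  ext c c'
  simp

lemma det_vandermonde_succAbove_sum {N : ℕ} (y : Fin (N + 1) → K) (s : ℕ) (hs : s ≤ N) :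
    ∑ j : Fin (N + 1), (-1) ^ (j : ℕ) * (vandermonde (fun i => y (j.succAbove i))).det * y j ^ s =
      if s = N then (-1) ^ N * (vandermonde y).det else 0 := by
  have key := Matrix.det_succ_column
    (Matrix.of fun i j : Fin (N + 1) => if j = Fin.last N then y i ^ s else y i ^ (j : ℕ))
    (Fin.last N)
  have hsub : ∀ i : Fin (N + 1), ((Matrix.of fun i j : Fin (N + 1) =>
      if j = Fin.last N then y i ^ s else y i ^ (j : ℕ)).submatrix i.succAbove
        (Fin.last N).succAbove) = vandermonde (fun k => y (i.succAbove k)) := by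
    intro i
    ext a b
    simp [vandermonde_apply, Fin.succAbove_last, Fin.castSucc_ne_last]
  have h1 : ∑ j : Fin (N + 1), (-1) ^ (j : ℕ) * (vandermonde (fun i => y (j.succAbove i))).det *
      y j ^ s = (-1) ^ N * Matrix.det (Matrix.of fun i j : Fin (N + 1) =>
        if j = Fin.last N then y i ^ s else y i ^ (j : ℕ)) := by
    rw [key, Finset.mul_sum]
    refine Finset.sum_congr rfl fun i _ => ?_
    rw [hsub]
    have : ((-1 : K) ^ N) * (-1) ^ N = 1 := by rw [← mul_pow]; simp
    simp only [of_apply, Fin.val_last, if_true, pow_add]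
    linear_combination (-(-1) ^ (i : ℕ) * (vandermonde (fun k => y (i.succAbove k))).det *
      y i ^ s) * this
  rw [h1]
  split_ifs with h
  · congr 2
    ext a b
    by_cases hb : b = Fin.last N
    · simp [hb, vandermonde_apply, h]
    · simp [hb, vandermonde_apply]
  · rw [Matrix.det_zero_of_column_eq (i := Fin.last N) (j := ⟨s, by omega⟩)]
    · simp
    · intro h'
      have := congrArg Fin.val h'
      simp at this
      omega
    · intro k
      have : (⟨s, by omega⟩ : Fin (N + 1)) ≠ Fin.last N := by
        intro h'
        have := congrArg Fin.val h'
        simp at this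
        omega
      simp [this]

/-- The product of the differences `y l - y j` over `l ≠ j`. -/
def diffProd {N : ℕ} (y : Fin N → K) (j : Fin N) : K :=
  ∏ l, if l = j then 1 else y l - y j

lemma diffProd_succAbove {N : ℕ} (y : Fin (N + 1) → K) (j : Fin (N + 1)) :
    diffProd y j = ∏ l, (y (j.succAbove l) - y j) := by
  unfold diffProd
  rw [Fin.prod_univ_succAbove _ j]
  simp [Fin.succAbove_ne]

lemma diffProd_succAbove_succAbove {N : ℕ} (y : Fin (N + 1) → K) (i : Fin (N + 1)) (j : Fin N) :
    diffProd y (i.succAbove j) =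
      (y i - y (i.succAbove j)) * diffProd (fun l => y (i.succAbove l)) j := by
  unfold diffProd
  rw [Fin.prod_univ_succAbove _ i]
  simp [(Fin.succAbove_ne i j).symm]

lemma comp_cycleRange_symm {N : ℕ} {α : Type*} (f : Fin (N + 1) → α) (j : Fin (N + 1)) :
    (fun i => f (j.cycleRange.symm i)) =
      Fin.cons (α := fun _ => α) (f j) (fun l => f (j.succAbove l)) := by
  funext i
  refine Fin.cases ?_ (fun l => ?_) i
  · simp [Fin.cycleRange_symm_zero]
  · simp [Fin.cycleRange_symm_succ]

lemma det_vandermonde_eq_diffProd {N : ℕ} (y : Fin (N + 1) → K) (j : Fin (N + 1)) :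
    (vandermonde y).det =
      (-1) ^ (j : ℕ) * diffProd y j * (vandermonde (fun l => y (j.succAbove l))).det := by
  have h := Matrix.det_permute j.cycleRange.symm (vandermonde y)
  have h2 : (vandermonde y).submatrix j.cycleRange.symm id =
      vandermonde (Fin.cons (α := fun _ => K) (y j) (fun l => y (j.succAbove l))) := by
    rw [← comp_cycleRange_symm]
    rfl
  rw [h2, Equiv.Perm.sign_symm, Fin.sign_cycleRange, Matrix.det_vandermonde,
    Fin.prod_univ_succ] at h
  simp only [Fin.Ioi_zero_eq_map, Finset.prod_map, Fin.cons_zero, Fin.coe_succEmb, Fin.cons_succ,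
    Fin.Ioi_succ] at h
  rw [← Matrix.det_vandermonde, ← diffProd_succAbove] at h
  push_cast at h
  have : ((-1 : K) ^ (j : ℕ)) * (-1) ^ (j : ℕ) = 1 := by rw [← mul_pow]; simp
  linear_combination (-(-1) ^ (j : ℕ)) * h - (vandermonde y).det * this

/-- The bidiagonal matrix subtracting `y₀` times the previous coordinate. -/
def bidiag (R : ℕ) (y₀ : K) : Matrix (Fin R) (Fin R) K :=
  Matrix.of fun k k' => if k = k' then 1 else if (k : ℕ) + 1 = k' then -y₀ else 0

lemma det_bidiag (R : ℕ) (y₀ : K) : (bidiag R y₀).det = 1 := by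
  rw [Matrix.det_of_isUpperTriangular]
  · simp [bidiag]
  · intro i j hij
    have : (j : ℕ) < i := hij
    simp only [bidiag, of_apply]
    rw [if_neg (by intro h; subst h; omega), if_neg (by omega)]

lemma sum_mul_bidiag_zero (R : ℕ) (y₀ : K) (g : Fin (R + 1) → K) :
    ∑ k, g k * bidiag (R + 1) y₀ k 0 = g 0 := by
  simp [bidiag]

lemma sum_mul_bidiag_succ (R : ℕ) (y₀ : K) (g : Fin (R + 1) → K) (k' : Fin R) :
    ∑ k, g k * bidiag (R + 1) y₀ k k'.succ = g k'.succ - y₀ * g k'.castSucc := by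
  have h : ∀ k : Fin (R + 1), g k * bidiag (R + 1) y₀ k k'.succ =
      (if k = k'.succ then g k'.succ else 0) + (if k = k'.castSucc then - y₀ * g k'.castSucc
        else 0) := by
    intro k
    simp only [bidiag, of_apply, Fin.val_succ]
    have h1 : k'.castSucc ≠ k'.succ := (Fin.castSucc_lt_succ).ne
    by_cases ha : k = k'.succ
    · subst ha; simp [h1.symm]
    · by_cases hb : k = k'.castSucc
      · subst hb; simp [h1]; ring
      · simp [ha, hb]
        intro h; exact absurd (Fin.ext (by simpa using h)) hb
  rw [Finset.sum_congr rfl fun k _ => h k, Finset.sum_add_distrib]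
  simp
  ring

/-- The identification of coordinates splitting off the coordinates `(0, t)`. -/
def splitEquiv {R : ℕ} (e' : C ≃ Fin R × Fin 4) : Fin 4 ⊕ C ≃ Fin (R + 1) × Fin 4 where
  toFun := Sum.elim (fun t => (0, t)) (fun c => ((e' c).1.succ, (e' c).2))
  invFun := fun p => Fin.cases (motive := fun _ => Fin 4 ⊕ C) (Sum.inl p.2)
    (fun k => Sum.inr (e'.symm (k, p.2))) p.1
  left_inv := by rintro (t | c) <;> simp
  right_inv := by
    rintro ⟨k, t⟩
    refine Fin.cases ?_ (fun k => ?_) k <;> simp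

lemma famDet_splitEquiv {R : ℕ} (e' : C ≃ Fin R × Fin 4) (y₀ : K) (q₀ : Fin 4 → Fin 4 → K)
    (y z : C → K) (q : C → Fin 4 → K) :
    famDet (splitEquiv e') (Sum.elim (fun i => colVec (R + 1) y₀ 1 (q₀ i))
        (fun c => colVec (R + 1) (y c) (z c) (q c))) =
      (Matrix.of q₀).det * (∏ c, (y c - y₀ * z c)) *
        famDet e' (fun c => colVec R (y c) (z c) (q c)) := by
  set f : Fin 4 ⊕ C → Fin (R + 1) × Fin 4 → K := Sum.elim (fun i => colVec (R + 1) y₀ 1 (q₀ i))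
        (fun c => colVec (R + 1) (y c) (z c) (q c)) with hf
  have hB : ((Matrix.kroneckerMap (fun a b : K => a * b) (bidiag (R + 1) y₀)
      (1 : Matrix (Fin 4) (Fin 4) K)).submatrix (splitEquiv e') (splitEquiv e')).det = 1 := by
    rw [Matrix.det_submatrix_equiv_self]
    have := Matrix.det_kronecker (bidiag (R + 1) y₀) (1 : Matrix (Fin 4) (Fin 4) K)
    rw [det_bidiag, det_one] at this
    simpa using this
  have hprod : (Matrix.of fun c c' => f c (splitEquiv e' c')) *
      ((Matrix.kroneckerMap (fun a b : K => a * b) (bidiag (R + 1) y₀)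
      (1 : Matrix (Fin 4) (Fin 4) K)).submatrix (splitEquiv e') (splitEquiv e')) =
      Matrix.of fun c c' => ∑ k, f c (k, (splitEquiv e' c').2) *
        bidiag (R + 1) y₀ k (splitEquiv e' c').1 := by
    ext c c'
    rw [Matrix.mul_apply]
    simp only [of_apply, submatrix_apply, kroneckerMap_apply]
    rw [Equiv.sum_comp (splitEquiv e') (fun p => f c p * (bidiag (R + 1) y₀ p.1
      (splitEquiv e' c').1 * (1 : Matrix (Fin 4) (Fin 4) K) p.2 (splitEquiv e' c').2)),
      Fintype.sum_prod_type]
    refine Finset.sum_congr rfl fun k _ => ?_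
    rw [Finset.sum_eq_single (splitEquiv e' c').2]
    · simp
    · intro b _ hb; simp [Matrix.one_apply_ne hb]
    · simp
  have hblock : (Matrix.of fun c c' => ∑ k, f c (k, (splitEquiv e' c').2) *
        bidiag (R + 1) y₀ k (splitEquiv e' c').1) =
      Matrix.fromBlocks (Matrix.of q₀) 0
        (Matrix.of fun c t => ∑ k, f (Sum.inr c) (k, t) * bidiag (R + 1) y₀ k 0)
        (Matrix.of fun c c' => (y c - y₀ * z c) * colVec R (y c) (z c) (q c) (e' c')) := by
    ext (i | c) (t | c')
    · simp only [of_apply, fromBlocks_apply₁₁]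
      change ∑ k, f (Sum.inl i) (k, t) * bidiag (R + 1) y₀ k 0 = _
      rw [sum_mul_bidiag_zero]
      simp [hf, colVec]
    · simp only [of_apply, fromBlocks_apply₁₂]
      change ∑ k, f (Sum.inl i) (k, (e' c').2) * bidiag (R + 1) y₀ k (e' c').1.succ = _
      rw [sum_mul_bidiag_succ (g := fun k => f (Sum.inl i) (k, (e' c').2))]
      simp [hf, colVec]
      ring
    · rfl
    · simp only [of_apply, fromBlocks_apply₂₂]
      change ∑ k, f (Sum.inr c) (k, (e' c').2) * bidiag (R + 1) y₀ k (e' c').1.succ = _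
      rw [sum_mul_bidiag_succ (g := fun k => f (Sum.inr c) (k, (e' c').2))]
      have hlt := (e' c').1.isLt
      simp only [hf, Sum.elim_inr, colVec, Fin.val_succ, Fin.val_castSucc]
      have h1 : R + 1 - 1 - ((e' c').1 + 1 : ℕ) = R - 1 - (e' c').1 := by omega
      have h2 : R + 1 - 1 - ((e' c').1 : ℕ) = R - 1 - (e' c').1 + 1 := by omega
      rw [h1, h2]
      ring
  unfold famDet
  rw [← mul_one (Matrix.det _), ← hB, ← Matrix.det_mul, hprod, hblock,
    Matrix.det_fromBlocks_zero₁₂]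
  have := Matrix.det_mul_column (fun c => y c - y₀ * z c)
    (Matrix.of fun c c' => colVec R (y c) (z c) (q c) (e' c'))
  simp only [of_apply] at this
  rw [this]
  ring

lemma famDet_collision {R : ℕ} (e : Fin 4 ⊕ C ≃ Fin (R + 1) × Fin 4) (e' : C ≃ Fin R × Fin 4) :
    ∃ u : ℤˣ, ∀ (y₀ : K) (q₀ : Fin 4 → Fin 4 → K) (y z : C → K) (q : C → Fin 4 → K),
      famDet e (Sum.elim (fun i => colVec (R + 1) y₀ 1 (q₀ i))
        (fun c => colVec (R + 1) (y c) (z c) (q c))) =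
      ((u : ℤ) : K) * ((Matrix.of q₀).det * (∏ c, (y c - y₀ * z c)) *
        famDet e' (fun c => colVec R (y c) (z c) (q c))) := by
  obtain ⟨u, hu⟩ := exists_famDet_eq (K := K) e (splitEquiv e') (Equiv.refl _)
  refine ⟨u, fun y₀ q₀ y z q => ?_⟩
  rw [hu]
  simp only [Equiv.refl_apply]
  rw [famDet_splitEquiv]

end FamDet

section Collision

variable {K : Type*} [Field K] {B : Type*} [Fintype B] [DecidableEq B]

/-- The columns attached to a list of points, two for each point. -/
def pts {N : ℕ} (R : ℕ) (y : Fin N → K) (q : Fin N → Fin 2 → Fin 4 → K) :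
    Fin N × Fin 2 → Fin R × Fin 4 → K :=
  fun p => colVec R (y p.1) 1 (q p.1 p.2)

/-- Permutations of the points act on the columns `Fin N × Fin 2` by even permutations. -/
lemma famDet_pts_perm {N R : ℕ} (e : (Fin N × Fin 2) ⊕ B ≃ Fin R × Fin 4)
    (y : Fin N → K) (q : Fin N → Fin 2 → Fin 4 → K) (b : B → Fin R × Fin 4 → K)
    (π : Equiv.Perm (Fin N)) :
    famDet e (Sum.elim (pts R (fun i => y (π i)) (fun i => q (π i))) b) =
      famDet e (Sum.elim (pts R y q) b) := by
  have h := famDet_perm e ((Equiv.prodCongrLeft (fun _ : Fin 2 => π)).sumCongr (Equiv.refl B))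
    (Sum.elim (pts R y q) b)
  have hs : Equiv.Perm.sign ((Equiv.prodCongrLeft (fun _ : Fin 2 => π)).sumCongr
      (Equiv.refl B)) = 1 := by
    erw [Equiv.Perm.sign_sumCongr, Equiv.Perm.sign_prodCongrLeft]
    simp
  rw [hs] at h
  simp only [Units.val_one, Int.cast_one, one_mul] at h
  rw [← h]
  congr 1
  funext c
  rcases c with ⟨i, ε⟩ | β <;> rfl

/-- Gathers the two columns of point `0` and the two columns of an extra pair. -/
def gatherEquiv (N : ℕ) (B : Type*) :
    Fin 4 ⊕ ((Fin N × Fin 2) ⊕ B) ≃ (Fin (N + 1) × Fin 2) ⊕ (Fin 2 ⊕ B) where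
  toFun := Sum.elim ![Sum.inl (0, 0), Sum.inl (0, 1), Sum.inr (Sum.inl 0), Sum.inr (Sum.inl 1)]
    (Sum.elim (fun p => Sum.inl (p.1.succ, p.2)) (fun β => Sum.inr (Sum.inr β)))
  invFun := Sum.elim
    (fun p => Fin.cases (motive := fun _ => Fin 4 ⊕ ((Fin N × Fin 2) ⊕ B))
      (Sum.inl (![0, 1] p.2)) (fun l => Sum.inr (Sum.inl (l, p.2))) p.1)
    (Sum.elim (fun ε => Sum.inl (![2, 3] ε)) (fun β => Sum.inr (Sum.inr β)))
  left_inv := by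
    rintro (t | ⟨l, ε⟩ | β)
    · fin_cases t <;> rfl
    · rfl
    · rfl
  right_inv := by
    rintro (⟨l, ε⟩ | ε | β)
    · refine Fin.cases ?_ (fun l => ?_) l
      · fin_cases ε <;> rfl
      · rfl
    · fin_cases ε <;> rfl
    · rfl

lemma point_collision {N R : ℕ} (e : (Fin (N + 1) × Fin 2) ⊕ (Fin 2 ⊕ B) ≃ Fin (R + 1) × Fin 4)
    (e' : (Fin N × Fin 2) ⊕ B ≃ Fin R × Fin 4) :
    ∃ u : ℤˣ, ∀ (y : Fin (N + 1) → K) (q : Fin (N + 1) → Fin 2 → Fin 4 → K)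
      (q' : Fin 2 → Fin 4 → K) (b : B → Fin 4 → K) (j : Fin (N + 1)),
      famDet e (Sum.elim (pts (R + 1) y q) (Sum.elim (fun ε => colVec (R + 1) (y j) 1 (q' ε))
        (fun β => colVec (R + 1) 1 0 (b β)))) =
      ((u : ℤ) : K) * ((Matrix.of ![q j 0, q j 1, q' 0, q' 1]).det * diffProd y j ^ 2 *
        famDet e' (Sum.elim (pts R (fun l => y (j.succAbove l)) (fun l => q (j.succAbove l)))
          (fun β => colVec R 1 0 (b β)))) := by
  obtain ⟨u₁, h₁⟩ := exists_famDet_eq (K := K) e ((gatherEquiv N B).trans e) (gatherEquiv N B)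
  obtain ⟨u₂, h₂⟩ := famDet_collision (K := K) ((gatherEquiv N B).trans e) e'
  refine ⟨u₁ * u₂, fun y q q' b j => ?_⟩
  rw [← famDet_pts_perm e y q _ j.cycleRange.symm, h₁]
  have h := h₂ (y j) ![q j 0, q j 1, q' 0, q' 1]
    (Sum.elim (fun p => y (j.succAbove p.1)) (fun _ => 1)) (Sum.elim (fun _ => 1) (fun _ => 0))
    (Sum.elim (fun p => q (j.succAbove p.1) p.2) b)
  have hL : (fun c => Sum.elim (pts (R + 1) (fun i => y (j.cycleRange.symm i))
      (fun i => q (j.cycleRange.symm i))) (Sum.elim (fun ε => colVec (R + 1) (y j) 1 (q' ε))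
        (fun β => colVec (R + 1) 1 0 (b β))) (gatherEquiv N B c)) =
      (Sum.elim (fun i => colVec (R + 1) (y j) 1 ((![q j 0, q j 1, q' 0, q' 1] :
          Fin 4 → Fin 4 → K) i))
        (fun c => colVec (R + 1) (Sum.elim (fun p : Fin N × Fin 2 => y (j.succAbove p.1))
          (fun _ : B => 1) c) (Sum.elim (fun _ => 1) (fun _ => 0) c)
          (Sum.elim (fun p => q (j.succAbove p.1) p.2) b c))) := by
    funext c
    rcases c with t | ⟨l, ε⟩ | β
    · fin_cases t <;> simp [gatherEquiv, pts]
    · simp [gatherEquiv, pts]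
    · simp [gatherEquiv]
  have hR : (fun c => colVec R (Sum.elim (fun p : Fin N × Fin 2 => y (j.succAbove p.1))
          (fun _ : B => 1) c) (Sum.elim (fun _ => 1) (fun _ => 0) c)
          (Sum.elim (fun p => q (j.succAbove p.1) p.2) b c)) =
      Sum.elim (pts R (fun l => y (j.succAbove l)) (fun l => q (j.succAbove l)))
          (fun β => colVec R 1 0 (b β)) := by
    funext c
    rcases c with ⟨l, ε⟩ | β <;> rfl
  rw [hL, h, hR, Fintype.prod_sum_type, Fintype.prod_prod_type, diffProd_succAbove]
  simp only [Sum.elim_inl, Sum.elim_inr, Fin.prod_univ_two, Finset.prod_mul_distrib]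
  simp only [mul_one, mul_zero, sub_zero, Finset.prod_const_one]
  push_cast
  ring

end Collision

section Interpolation

variable {K : Type*} [Field K] {A B : Type*} [Fintype A] [DecidableEq A]
  [Fintype B] [DecidableEq B]

/-- The vector `q` placed in the block of coordinates with index `k`. -/
def blockVec {R : ℕ} (k : Fin R) (q : Fin 4 → K) : Fin R × Fin 4 → K :=
  fun p => if p.1 = k then q p.2 else 0

lemma colVec_eq_sum {R : ℕ} (Y : K) (q : Fin 4 → K) :
    colVec R Y 1 q = ∑ k : Fin R, Y ^ (k : ℕ) • blockVec k q := by
  funext p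
  simp [colVec, blockVec, Finset.sum_apply]

lemma colVec_one_zero {R : ℕ} (q : Fin 4 → K) :
    colVec (R + 1) 1 0 q = blockVec (Fin.last R) q := by
  funext p
  simp only [colVec, blockVec, one_pow, one_mul]
  by_cases h : p.1 = Fin.last R
  · simp [h]
  · have : (p.1 : ℕ) ≠ R := fun h' => h (Fin.ext h')
    rw [if_neg h, zero_pow (by omega), zero_mul]

lemma famDet_update_sum {C ρ ι : Type*} [Fintype C] [DecidableEq C] [Fintype ι] (e : C ≃ ρ)
    (f : C → ρ → K) (c : C) (a : ι → K) (v : ι → ρ → K) :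
    famDet e (Function.update f c (∑ k, a k • v k)) =
      ∑ k, a k * famDet e (Function.update f c (v k)) := by
  have h : ∀ w : ρ → K, famDet e (Function.update f c w) =
      Matrix.detRowAlternating (Function.update (fun c' => fun c'' => f c' (e c'')) c
        (fun c'' => w (e c''))) := by
    intro w
    unfold famDet
    change Matrix.det _ = Matrix.det _
    congr 1
    ext c' c''
    by_cases hc : c' = c
    · subst hc; simp
    · simp [hc]
  simp only [h]
  have hs : (fun c'' => (∑ k, a k • v k) (e c'')) = ∑ k, a k • (fun c'' => v k (e c'')) := by
    funext c''; simp [Finset.sum_apply]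
  rw [hs, AlternatingMap.map_update_sum]
  refine Finset.sum_congr rfl fun k _ => ?_
  rw [AlternatingMap.map_update_smul, smul_eq_mul]

lemma famDet_eq_zero {C ρ : Type*} [Fintype C] [DecidableEq C] (e : C ≃ ρ) (f : C → ρ → K)
    {c c' : C} (hc : c ≠ c') (h : f c = f c') : famDet e f = 0 := by
  unfold famDet
  exact Matrix.det_zero_of_row_eq hc (by funext k; simp [h])

lemma famDet_pair_expand {R : ℕ} (e : A ⊕ (Fin 2 ⊕ B) ≃ Fin R × Fin 4)
    (P : A → Fin R × Fin 4 → K) (b : B → Fin R × Fin 4 → K) (q : Fin 2 → Fin 4 → K) (Y : K) :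
    famDet e (Sum.elim P (Sum.elim (fun ε => colVec R Y 1 (q ε)) b)) =
      ∑ k : Fin R, ∑ k' : Fin R, Y ^ ((k : ℕ) + k') *
        famDet e (Sum.elim P (Sum.elim ![blockVec k (q 0), blockVec k' (q 1)] b)) := by
  have h0 : ∀ v w w' : Fin R × Fin 4 → K, (Sum.elim P (Sum.elim ![v, w] b)) =
      Function.update (Sum.elim P (Sum.elim ![w', w] b)) (Sum.inr (Sum.inl 0)) v := by
    intro v w w'
    funext c
    rcases c with a | ε | β
    · simp
    · fin_cases ε <;> simp
    · simp
  have h1 : ∀ v w w' : Fin R × Fin 4 → K, (Sum.elim P (Sum.elim ![v, w] b)) =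
      Function.update (Sum.elim P (Sum.elim ![v, w'] b)) (Sum.inr (Sum.inl 1)) w := by
    intro v w w'
    funext c
    rcases c with a | ε | β
    · simp
    · fin_cases ε <;> simp
    · simp
  have hv : (fun ε => colVec R Y 1 (q ε)) = ![colVec R Y 1 (q 0), colVec R Y 1 (q 1)] := by
    funext ε; fin_cases ε <;> rfl
  rw [hv, h0 _ _ 0, colVec_eq_sum Y (q 0), famDet_update_sum]
  refine Finset.sum_congr rfl fun k _ => ?_
  rw [← h0, h1 _ _ 0, colVec_eq_sum Y (q 1), famDet_update_sum, Finset.mul_sum]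
  refine Finset.sum_congr rfl fun k' _ => ?_
  rw [← h1]
  ring

lemma sum_vandermonde_interpolation {N R : ℕ} (y : Fin (N + 1) → K) (g : Fin R → Fin R → K)
    (hg : ∀ k k' : Fin R, N < (k : ℕ) + k' → g k k' = 0) :
    ∑ j : Fin (N + 1), (-1) ^ (j : ℕ) * (vandermonde (fun i => y (j.succAbove i))).det *
      (∑ k : Fin R, ∑ k' : Fin R, y j ^ ((k : ℕ) + k') * g k k') =
      (-1) ^ N * (vandermonde y).det *
        ∑ k : Fin R, ∑ k' : Fin R, if (k : ℕ) + k' = N then g k k' else 0 := by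
  simp only [Finset.mul_sum]
  rw [Finset.sum_comm]
  refine Finset.sum_congr rfl fun k _ => ?_
  rw [Finset.sum_comm]
  refine Finset.sum_congr rfl fun k' _ => ?_
  by_cases h : (k : ℕ) + k' ≤ N
  · have := det_vandermonde_succAbove_sum y _ h
    simp only [← mul_assoc]
    rw [← Finset.sum_mul, this]
    split_ifs <;> ring
  · rw [if_neg (by omega), hg k k' (by omega)]
    simp

end Interpolation

section SymplecticDet

variable {K : Type*} [Field K]

/-- The antisymmetric Laurent polynomial `x ^ l - x ^ (-l)`. -/
def sv (l : ℕ) (x : K) : K := x ^ l - x⁻¹ ^ l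

/-- The `x ↔ x⁻¹` invariant coordinate `x + x⁻¹`. -/
def yv (x : K) : K := x + x⁻¹

/-- The two vectors `(z ^ M, z ^ (M + 1), 1, z)` for `z = x` and `z = x⁻¹`. -/
def qv (M : ℕ) (x : K) : Fin 2 → Fin 4 → K :=
  ![![x ^ M, x ^ (M + 1), 1, x], ![x⁻¹ ^ M, x⁻¹ ^ (M + 1), 1, x⁻¹]]

/-- The antisymmetric kernel `∑_{l < M} (S_{l+1}(x) S_l(w) - S_l(x) S_{l+1}(w))`. -/
def svKernel (M : ℕ) (x w : K) : K :=
  ∑ l : Fin M, (sv (l + 1) x * sv l w - sv l x * sv (l + 1) w)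

/-- The determinant of the matrix with entries `x_j ^ ρ_i - x_j ^ (-ρ_i)`. -/
def svDet {n : ℕ} (ρ : Fin n → ℕ) (x : Fin n → K) : K :=
  Matrix.det (Matrix.of fun i j => sv (ρ i) (x j))

lemma svKernel_mul (M : ℕ) {x w : K} (hx : x ≠ 0) (hw : w ≠ 0) :
    (yv x - yv w) * svKernel M x w =
      (x ^ M * x - x⁻¹ ^ M * x⁻¹) * (w ^ M * w⁻¹ - w⁻¹ ^ M * w) +
      (x ^ M * x⁻¹ - x⁻¹ ^ M * x) * (w ^ M * w - w⁻¹ ^ M * w⁻¹) -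
      2 * sv M x * sv M w + 2 * (x - x⁻¹) * (w - w⁻¹) := by
  unfold svKernel
  induction M with
  | zero => simp [sv]; ring
  | succ M ih =>
    rw [Fin.sum_univ_castSucc, mul_add]
    simp only [Fin.val_castSucc, Fin.val_last]
    rw [ih]
    simp only [sv, yv, pow_succ]
    generalize x ^ M = a
    generalize x⁻¹ ^ M = a'
    generalize w ^ M = b
    generalize w⁻¹ ^ M = b'
    field_simp
    ring

lemma det_qv (M : ℕ) {x w : K} (hx : x ≠ 0) (hw : w ≠ 0) :
    (Matrix.of ![qv M x 0, qv M x 1, qv M w 0, qv M w 1]).det = (yv x - yv w) * svKernel M x w := by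
  rw [svKernel_mul M hx hw]
  rw [Matrix.det_succ_row_zero]
  simp [Fin.sum_univ_succ, Matrix.det_fin_three, qv, sv, pow_succ, Fin.succAbove]
  have ha : x ^ M ≠ 0 := pow_ne_zero _ hx
  have hb : w ^ M ≠ 0 := pow_ne_zero _ hw
  generalize x ^ M = a at *
  generalize w ^ M = b at *
  field_simp
  ring

end SymplecticDet

section PairSums

variable {K : Type*} [Field K]

/-- The row exponents `l₀ + 1, l₀, l₁ + 1, l₁, …`. -/
def pairRows {r : ℕ} (l : Fin r → ℕ) : Fin (2 * r) → ℕ :=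
  fun j => l ⟨j / 2, by have := j.isLt; omega⟩ + 1 - j % 2

/-- The sum of the determinants whose rows are consecutive pairs with indices below `M`. -/
def pairSum (M r : ℕ) (x : Fin (2 * r) → K) : K :=
  ∑ s : Fin r → Fin M, svDet (pairRows fun i => (s i : ℕ)) x

/-- As `pairSum`, with a last row of exponent `1`. -/
def pairSumOne (M r : ℕ) (x : Fin (2 * r + 1) → K) : K :=
  ∑ s : Fin r → Fin M, svDet (Fin.snoc (α := fun _ => ℕ) (pairRows fun i => (s i : ℕ)) 1) x

/-- As `pairSumOne`, with a first row of exponent `M`. -/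
def pairSumTop (M r : ℕ) (x : Fin (2 * r + 2) → K) : K :=
  ∑ s : Fin r → Fin M, svDet (Fin.cons (α := fun _ => ℕ) M
    (Fin.snoc (α := fun _ => ℕ) (pairRows fun i => (s i : ℕ)) 1)) x

lemma svDet_cons {n : ℕ} (a : ℕ) (ρ : Fin n → ℕ) (x : Fin (n + 1) → K) :
    svDet (Fin.cons (α := fun _ => ℕ) a ρ) x =
      ∑ i : Fin (n + 1), (-1) ^ (i : ℕ) * sv a (x i) * svDet ρ (fun k => x (i.succAbove k)) := by
  unfold svDet
  rw [Matrix.det_succ_row_zero]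
  rfl

lemma svDet_snoc {n : ℕ} (a : ℕ) (ρ : Fin n → ℕ) (x : Fin (n + 1) → K) :
    svDet (Fin.snoc (α := fun _ => ℕ) ρ a) x =
      ∑ i : Fin (n + 1), (-1) ^ (n + i : ℕ) * sv a (x i) * svDet ρ (fun k => x (i.succAbove k)) := by
  unfold svDet
  rw [Matrix.det_succ_row _ (Fin.last n)]
  refine Finset.sum_congr rfl fun i _ => ?_
  simp only [Fin.val_last, of_apply, Fin.snoc_last]
  congr 2
  ext k l
  simp [Fin.succAbove_last]

lemma svDet_perm {n : ℕ} (π : Equiv.Perm (Fin n)) (ρ : Fin n → ℕ) (x : Fin n → K) :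
    svDet (fun i => ρ (π i)) x = ((Equiv.Perm.sign π : ℤ) : K) * svDet ρ x := by
  unfold svDet
  rw [← Matrix.det_permute]
  rfl

lemma svDet_cons_cons {n : ℕ} (a b : ℕ) (ρ : Fin n → ℕ) (x : Fin (n + 2) → K) :
    svDet (Fin.cons (α := fun _ => ℕ) a (Fin.cons (α := fun _ => ℕ) b ρ)) x =
      ∑ i : Fin (n + 2), ∑ j : Fin (n + 1), (-1) ^ (i + j : ℕ) * (sv a (x i) * sv b (x (i.succAbove j))) *
        svDet ρ (fun k => x (i.succAbove (j.succAbove k))) := by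
  rw [svDet_cons]
  refine Finset.sum_congr rfl fun i _ => ?_
  rw [svDet_cons, Finset.mul_sum]
  refine Finset.sum_congr rfl fun j _ => ?_
  ring

lemma svDet_cons_cons_swap {n : ℕ} (a b : ℕ) (ρ : Fin n → ℕ) (x : Fin (n + 2) → K) :
    svDet (Fin.cons (α := fun _ => ℕ) a (Fin.cons (α := fun _ => ℕ) b ρ)) x =
      - svDet (Fin.cons (α := fun _ => ℕ) b (Fin.cons (α := fun _ => ℕ) a ρ)) x := by
  have h := svDet_perm (Equiv.swap (0 : Fin (n + 2)) 1)
    (Fin.cons (α := fun _ => ℕ) b (Fin.cons (α := fun _ => ℕ) a ρ)) x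
  rw [Equiv.Perm.sign_swap (by simp)] at h
  have h2 : (fun i => Fin.cons (α := fun _ => ℕ) b (Fin.cons (α := fun _ => ℕ) a ρ)
      (Equiv.swap (0 : Fin (n + 2)) 1 i)) =
      (Fin.cons (α := fun _ => ℕ) a (Fin.cons (α := fun _ => ℕ) b ρ) : Fin (n + 2) → ℕ) := by
    funext i
    refine Fin.cases ?_ (fun i => Fin.cases ?_ (fun i => ?_) i) i
    · rw [Equiv.swap_apply_left]; rfl
    · change Fin.cons (α := fun _ => ℕ) b (Fin.cons (α := fun _ => ℕ) a ρ)
        (Equiv.swap (0 : Fin (n + 2)) 1 1) = _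
      rw [Equiv.swap_apply_right]; rfl
    · rw [Equiv.swap_apply_of_ne_of_ne (Fin.succ_ne_zero _)]
      · rfl
      · rw [← Fin.succ_zero_eq_one]
        exact fun h => Fin.succ_ne_zero _ (Fin.succ_injective _ h)
  rw [h2] at h
  rw [h]
  simp

lemma pairRows_of_div {r : ℕ} (l : Fin r → ℕ) (j : Fin (2 * r)) (i : Fin r)
    (h : (j : ℕ) / 2 = i) : pairRows l j = l i + 1 - j % 2 := by
  have : (⟨(j : ℕ) / 2, by have := j.isLt; omega⟩ : Fin r) = i := Fin.ext h
  simp only [pairRows, this]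

lemma pairRows_cons {r : ℕ} (a : ℕ) (l : Fin r → ℕ) :
    pairRows (Fin.cons (α := fun _ => ℕ) a l) =
      Fin.cons (α := fun _ => ℕ) (n := 2 * r + 1) (a + 1)
        (Fin.cons (α := fun _ => ℕ) a (pairRows l)) := by
  funext j
  refine Fin.cases (n := 2 * r + 1) ?_ (fun j => Fin.cases ?_ (fun j => ?_) j) j
  · rw [pairRows_of_div (r := r + 1) _ _ 0 (by erw [Fin.val_zero])]
    erw [Fin.val_zero]
    simp
  · rw [pairRows_of_div (r := r + 1) _ _ 0 (by erw [Fin.val_succ, Fin.val_zero])]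
    erw [Fin.val_succ, Fin.val_zero]
    simp
  · have hj : ((j.succ.succ : Fin (2 * r + 2)) : ℕ) = (j : ℕ) + 2 := rfl
    have hlt := j.isLt
    rw [pairRows_of_div (r := r + 1) _ _ (⟨(j : ℕ) / 2, by omega⟩ : Fin r).succ
      (by erw [hj, Fin.val_succ]; simp), Fin.cons_succ]
    erw [hj]
    simp [pairRows]

lemma sum_comm_four {α β γ δ : Type*} [Fintype α] [Fintype β] [Fintype γ] [Fintype δ]
    (f : α → β → γ → δ → K) :
    ∑ a, ∑ b, ∑ c, ∑ d, f a b c d = ∑ c, ∑ d, ∑ a, ∑ b, f a b c d := by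
  have := Finset.sum_comm (s := (Finset.univ : Finset (α × β)))
    (t := (Finset.univ : Finset (γ × δ))) (f := fun p q => f p.1 p.2 q.1 q.2)
  simpa only [Fintype.sum_prod_type] using this

lemma pairSum_succ (M r : ℕ) (x : Fin (2 * (r + 1)) → K) :
    ∑ i : Fin (2 * r + 2), ∑ j : Fin (2 * r + 1), (-1) ^ (i + j : ℕ) *
        svKernel M (x i) (x (i.succAbove j)) *
          pairSum M r (fun k => x (i.succAbove (j.succAbove k))) =
      2 * pairSum M (r + 1) x := by
  have h1 : pairSum M (r + 1) x = ∑ l : Fin M, ∑ s : Fin r → Fin M,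
      svDet (Fin.cons (α := fun _ => ℕ) ((l : ℕ) + 1)
        (Fin.cons (α := fun _ => ℕ) (l : ℕ) (pairRows fun i => (s i : ℕ)))) x := by
    unfold pairSum
    rw [← Equiv.sum_comp (Fin.consEquiv fun _ : Fin (r + 1) => Fin M), Fintype.sum_prod_type]
    refine Finset.sum_congr rfl fun l _ => Finset.sum_congr rfl fun s _ => ?_
    have : (fun i => ((Fin.consEquiv (fun _ : Fin (r + 1) => Fin M)) (l, s) i : ℕ)) =
        Fin.cons (α := fun _ => ℕ) (l : ℕ) (fun i => (s i : ℕ)) := by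
      funext i
      refine Fin.cases ?_ (fun i => ?_) i <;> simp [Fin.consEquiv]
    rw [this, pairRows_cons]
  have h2 : 2 * pairSum M (r + 1) x = ∑ l : Fin M, ∑ s : Fin r → Fin M,
      (svDet (Fin.cons (α := fun _ => ℕ) ((l : ℕ) + 1)
        (Fin.cons (α := fun _ => ℕ) (l : ℕ) (pairRows fun i => (s i : ℕ)))) x -
      svDet (Fin.cons (α := fun _ => ℕ) (l : ℕ)
        (Fin.cons (α := fun _ => ℕ) ((l : ℕ) + 1) (pairRows fun i => (s i : ℕ)))) x) := by
    rw [h1, Finset.mul_sum]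
    refine Finset.sum_congr rfl fun l _ => ?_
    rw [Finset.mul_sum]
    refine Finset.sum_congr rfl fun s _ => ?_
    rw [svDet_cons_cons_swap (l : ℕ)]
    ring
  rw [h2]
  simp only [svDet_cons_cons, ← Finset.sum_sub_distrib]
  rw [sum_comm_four]
  refine Finset.sum_congr rfl fun i _ => Finset.sum_congr rfl fun j _ => ?_
  rw [svKernel, pairSum, mul_assoc, Finset.sum_mul_sum, Finset.mul_sum]
  refine Finset.sum_congr rfl fun l _ => ?_
  rw [Finset.mul_sum]
  refine Finset.sum_congr rfl fun s _ => ?_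
  ring

end PairSums

section Levels

variable {K : Type*} [Field K]

/-- Reinterprets an extra pair of columns as the columns of a new point `0`. -/
def absorbEquiv (N : ℕ) : (Fin N × Fin 2) ⊕ (Fin 2 ⊕ Fin 0) ≃ (Fin (N + 1) × Fin 2) ⊕ Fin 0 where
  toFun := Sum.elim (fun p => Sum.inl (p.1.succ, p.2))
    (Sum.elim (fun ε => Sum.inl (0, ε)) (fun β => Sum.inr β))
  invFun := Sum.elim
    (fun p => Fin.cases (motive := fun _ => (Fin N × Fin 2) ⊕ (Fin 2 ⊕ Fin 0))
      (Sum.inr (Sum.inl p.2)) (fun l => Sum.inl (l, p.2)) p.1)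
    (fun β => Sum.inr (Sum.inr β))
  left_inv := by rintro (⟨l, ε⟩ | ε | β) <;> rfl
  right_inv := by
    rintro (⟨l, ε⟩ | β)
    · refine Fin.cases ?_ (fun l => ?_) l <;> rfl
    · rfl

lemma famDet_absorb {N R : ℕ} (e : (Fin (N + 1) × Fin 2) ⊕ Fin 0 ≃ Fin R × Fin 4)
    (e₁ : (Fin N × Fin 2) ⊕ (Fin 2 ⊕ Fin 0) ≃ Fin R × Fin 4) :
    ∃ u : ℤˣ, ∀ (y : Fin (N + 1) → K) (q : Fin (N + 1) → Fin 2 → Fin 4 → K)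
      (b : Fin 0 → Fin R × Fin 4 → K) (i : Fin (N + 1)),
      famDet e (Sum.elim (pts R y q) b) = ((u : ℤ) : K) *
        famDet e₁ (Sum.elim (pts R (fun l => y (i.succAbove l)) (fun l => q (i.succAbove l)))
          (Sum.elim (fun ε => colVec R (y i) 1 (q i ε)) b)) := by
  obtain ⟨u, hu⟩ := exists_famDet_eq (K := K) e e₁ (absorbEquiv N)
  refine ⟨u, fun y q b i => ?_⟩
  rw [← famDet_pts_perm e y q _ i.cycleRange.symm, hu]
  congr 2
  funext c
  rcases c with ⟨l, ε⟩ | ε | β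
  · simp [absorbEquiv, pts]
  · simp [absorbEquiv, pts]
  · exact β.elim0

/-- The points attached to `x`, in the basis `(z ^ M, z ^ (M + 1), 1, z)`. -/
def xpts {N : ℕ} (R M : ℕ) (x : Fin N → K) : Fin N × Fin 2 → Fin R × Fin 4 → K :=
  pts R (fun i => yv (x i)) (fun i => qv M (x i))

/-- The Vandermonde determinant in the coordinates `x + x⁻¹`. -/
def yvDet {N : ℕ} (x : Fin N → K) : K := (vandermonde fun i => yv (x i)).det

lemma yvDet_ne_zero {N : ℕ} {x : Fin N → K} (h : Function.Injective fun i => yv (x i)) :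
    yvDet x ≠ 0 := by
  unfold yvDet
  exact Matrix.det_vandermonde_ne_zero_iff.mpr h

lemma injective_comp_succAbove {N : ℕ} {x : Fin (N + 1) → K}
    (h : Function.Injective fun i => yv (x i)) (j : Fin (N + 1)) :
    Function.Injective fun i => yv (x (j.succAbove i)) :=
  fun _ _ hab => Fin.succAbove_right_injective (h hab)

lemma intUnit_ne_zero (u : ℤˣ) : ((u : ℤ) : K) ≠ 0 := by
  rcases Int.units_eq_one_or u with h | h <;> simp [h]

lemma svKernel_antisymm (M : ℕ) (x w : K) : svKernel M x w = -svKernel M w x := by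
  unfold svKernel
  rw [← Finset.sum_neg_distrib]
  exact Finset.sum_congr rfl fun l _ => by ring

lemma exists_famDet_absorb_eq {r : ℕ} (e : (Fin (2 * r + 2) × Fin 2) ⊕ Fin 0 ≃ Fin (r + 1) × Fin 4)
    (e₀ : (Fin (2 * r) × Fin 2) ⊕ Fin 0 ≃ Fin r × Fin 4) :
    ∃ u : ℤˣ, ∀ (M : ℕ) (x : Fin (2 * r + 2) → K), (∀ i, x i ≠ 0) →
      (Function.Injective fun i => yv (x i)) → ∀ (c : K) (h : (Fin (2 * r) → K) → K),
      (∀ i : Fin (2 * r + 2), ∀ j : Fin (2 * r + 1),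
        famDet e₀ (Sum.elim (xpts r M fun k => x (i.succAbove (j.succAbove k)))
          (fun β => Fin.elim0 β)) =
          c * yvDet (fun k => x (i.succAbove (j.succAbove k))) *
            h (fun k => x (i.succAbove (j.succAbove k)))) →
      ∀ i : Fin (2 * r + 2),
        famDet e (Sum.elim (xpts (r + 1) M x) (fun β => Fin.elim0 β)) =
          ((u : ℤ) : K) * c * yvDet x * ∑ j : Fin (2 * r + 1), (-1) ^ (i + j : ℕ) *
            svKernel M (x i) (x (i.succAbove j)) *
              h (fun k => x (i.succAbove (j.succAbove k))) := by
  have e₁ : (Fin (2 * r + 1) × Fin 2) ⊕ (Fin 2 ⊕ Fin 0) ≃ Fin (r + 1) × Fin 4 :=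
    Fintype.equivOfCardEq (by simp; ring)
  obtain ⟨u₁, h₁⟩ := famDet_absorb (K := K) e e₁
  obtain ⟨u₂, h₂⟩ := point_collision (K := K) e₁ e₀
  refine ⟨-(u₁ * u₂), fun M x hx hinj c h hrec i => ?_⟩
  set y : Fin (2 * r + 2) → K := fun i => yv (x i) with hy
  set q : Fin (2 * r + 2) → Fin 2 → Fin 4 → K := fun i => qv M (x i) with hq
  have hG : ∀ i', famDet e₁ (Sum.elim (pts (r + 1) (fun l => y (i.succAbove l))
      (fun l => q (i.succAbove l))) (Sum.elim (fun ε => colVec (r + 1) (y i') 1 (q i ε))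
        (fun β => Fin.elim0 β))) = _ :=
    fun i' => famDet_pair_expand e₁ _ _ _ (y i')
  have hsum := sum_vandermonde_interpolation (N := 2 * r + 1) (R := r + 1) y
    (fun k k' => famDet e₁ (Sum.elim (pts (r + 1) (fun l => y (i.succAbove l))
      (fun l => q (i.succAbove l))) (Sum.elim ![blockVec k (q i 0), blockVec k' (q i 1)]
        (fun β => Fin.elim0 β)))) (fun k k' hk => by omega)
  simp only [← hG] at hsum
  rw [Finset.sum_eq_zero (s := Finset.univ) (f := fun k : Fin (r + 1) => ∑ k' : Fin (r + 1), _)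
    (fun k _ => Finset.sum_eq_zero fun k' _ => if_neg (by omega)), mul_zero,
    Fin.sum_univ_succAbove _ i] at hsum
  have hD := h₁ y q (fun β => Fin.elim0 β) i
  have hVi : yvDet (fun k => x (i.succAbove k)) ≠ 0 :=
    yvDet_ne_zero (injective_comp_succAbove hinj i)
  have hterm : ∀ j : Fin (2 * r + 1),
      (-1) ^ ((i.succAbove j : Fin (2 * r + 2)) : ℕ) *
        (vandermonde (fun k => y ((i.succAbove j).succAbove k))).det *
        famDet e₁ (Sum.elim (pts (r + 1) (fun l => y (i.succAbove l))
          (fun l => q (i.succAbove l))) (Sum.elim (fun ε => colVec (r + 1)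
            (y (i.succAbove j)) 1 (q i ε)) (fun β => Fin.elim0 β))) =
      (((u₂ : ℤ) : K) * c * yvDet x * yvDet (fun k => x (i.succAbove k))) * ((-1) ^ (j : ℕ) *
        svKernel M (x i) (x (i.succAbove j)) *
          h (fun k => x (i.succAbove (j.succAbove k)))) := by
    intro j
    have hcol := h₂ (fun l => y (i.succAbove l)) (fun l => q (i.succAbove l)) (q i)
      (fun β => Fin.elim0 β) j
    have hb : (fun β : Fin 0 => colVec (K := K) (r + 1) 1 0 (Fin.elim0 β)) =
      (fun β => Fin.elim0 β) := Subsingleton.elim _ _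
    have hb' : (fun β : Fin 0 => colVec (K := K) r 1 0 (Fin.elim0 β)) =
      (fun β => Fin.elim0 β) := Subsingleton.elim _ _
    rw [hb, hb'] at hcol
    have hr := hrec i j
    rw [xpts] at hr
    rw [hcol, hr]
    have hd4 : (Matrix.of ![q (i.succAbove j) 0, q (i.succAbove j) 1, q i 0, q i 1]).det = _ :=
      det_qv M (hx (i.succAbove j)) (hx i)
    have hv1 := det_vandermonde_eq_diffProd y (i.succAbove j)
    rw [diffProd_succAbove_succAbove] at hv1
    have hv2 := det_vandermonde_eq_diffProd (fun l => y (i.succAbove l)) j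
    rw [hd4, svKernel_antisymm M (x (i.succAbove j)) (x i)]
    change yvDet x = _ * ((yv (x i) - yv (x (i.succAbove j))) * _) * _ at hv1
    change yvDet (fun k => x (i.succAbove k)) = _ * _ *
      yvDet (fun k => x (i.succAbove (j.succAbove k))) at hv2
    rw [hv1, hv2]
    have hs : ((-1 : K) ^ (j : ℕ)) * (-1) ^ (j : ℕ) = 1 := by rw [← mul_pow]; simp
    generalize (vandermonde fun k => y ((i.succAbove j).succAbove k)).det = V'
    generalize diffProd (fun l => y (i.succAbove l)) j = d
    generalize yvDet (fun k => x (i.succAbove (j.succAbove k))) = V''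
    generalize h (fun k => x (i.succAbove (j.succAbove k))) = hh
    generalize svKernel M (x i) (x (i.succAbove j)) = s
    generalize ((-1 : K) ^ (j : ℕ)) = sj at *
    linear_combination (-(-1) ^ ((i.succAbove j : Fin (2 * r + 2)) : ℕ) *
      (yv (x i) - yv (x (i.succAbove j))) * d ^ 2 * V' * V'' * ((u₂ : ℤ) : K) * c * s * hh) * hs
  rw [Finset.sum_congr rfl fun j _ => hterm j, ← Finset.mul_sum] at hsum
  have hxp : xpts (r + 1) M x = pts (r + 1) y q := rfl
  rw [hxp, hD]
  change (-1) ^ (i : ℕ) * yvDet (fun k => x (i.succAbove k)) * _ + _ = _ at hsum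
  have hs : ((-1 : K) ^ (i : ℕ)) * (-1) ^ (i : ℕ) = 1 := by rw [← mul_pow]; simp
  have hout : ∑ j : Fin (2 * r + 1), (-1 : K) ^ (i + j : ℕ) *
      svKernel M (x i) (x (i.succAbove j)) * h (fun k => x (i.succAbove (j.succAbove k))) =
      (-1) ^ (i : ℕ) * ∑ j : Fin (2 * r + 1), (-1) ^ (j : ℕ) *
      svKernel M (x i) (x (i.succAbove j)) * h (fun k => x (i.succAbove (j.succAbove k))) := by
    rw [Finset.mul_sum]
    refine Finset.sum_congr rfl fun j _ => ?_
    ring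
  rw [hout]
  apply mul_left_cancel₀ hVi
  push_cast
  linear_combination ((-1) ^ (i : ℕ) * ((u₁ : ℤ) : K)) * hsum -
    yvDet (fun k => x (i.succAbove k)) * ((u₁ : ℤ) : K) * famDet e₁ (Sum.elim (pts (r + 1)
      (fun l => y (i.succAbove l)) (fun l => q (i.succAbove l)))
      (Sum.elim (fun ε => colVec (r + 1) (y i) 1 (q i ε)) (fun β => Fin.elim0 β))) * hs

/-- The determinant of all the point columns is a Vandermonde determinant times `pairSum`. -/
lemma exists_famDet_eq_pairSum [CharZero K] (r : ℕ)
    (e : (Fin (2 * r) × Fin 2) ⊕ Fin 0 ≃ Fin r × Fin 4) :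
    ∃ c : K, c ≠ 0 ∧ ∀ (M : ℕ) (x : Fin (2 * r) → K), (∀ i, x i ≠ 0) →
      (Function.Injective fun i => yv (x i)) →
        famDet e (Sum.elim (xpts r M x) (fun β => Fin.elim0 β)) =
          c * yvDet x * pairSum M r x := by
  induction r with
  | zero =>
    refine ⟨1, one_ne_zero, fun M x _ _ => ?_⟩
    have h1 : yvDet x = 1 := Matrix.det_isEmpty (n := Fin 0)
    have h2 : pairSum M 0 x = 1 := by
      unfold pairSum svDet
      rw [Fintype.sum_unique]
      exact Matrix.det_isEmpty (n := Fin 0)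
    rw [h1, h2]
    have : IsEmpty ((Fin (2 * 0) × Fin 2) ⊕ Fin 0) := by
      rw [isEmpty_sum]
      exact ⟨⟨fun p => Fin.elim0 (p.1 : Fin 0)⟩, inferInstance⟩
    unfold famDet
    rw [Matrix.det_isEmpty]
    ring
  | succ r ih =>
    have e₀ : (Fin (2 * r) × Fin 2) ⊕ Fin 0 ≃ Fin r × Fin 4 :=
      Fintype.equivOfCardEq (by simp; ring)
    obtain ⟨c, hc, hrec⟩ := ih e₀
    obtain ⟨u, hu⟩ := exists_famDet_absorb_eq (K := K) e e₀
    have hr : ((r : K) + 1) ≠ 0 := by exact_mod_cast Nat.succ_ne_zero r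
    refine ⟨((u : ℤ) : K) * c / (r + 1), div_ne_zero (mul_ne_zero (intUnit_ne_zero u) hc) hr,
      fun M x hx hinj => ?_⟩
    have h := hu M x hx hinj c (pairSum M r) (fun i j => hrec M _ (fun k => hx _)
      (injective_comp_succAbove (injective_comp_succAbove (N := 2 * r + 1) hinj i) j))
    have hs := Finset.sum_congr (rfl : (Finset.univ : Finset (Fin (2 * r + 2))) = _)
      (fun i _ => h i)
    rw [← Finset.mul_sum, pairSum_succ, Finset.sum_const, Finset.card_univ, Fintype.card_fin,
      nsmul_eq_mul] at hs
    push_cast at hs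
    have h2 : (2 : K) ≠ 0 := two_ne_zero
    field_simp
    apply mul_left_cancel₀ h2
    linear_combination hs

end Levels

section BackgroundLevels

variable {K : Type*} [Field K]

lemma det_qv_single_zero_one (M : ℕ) (x : K) :
    (Matrix.of ![qv M x 0, qv M x 1, Pi.single 0 1, Pi.single 1 1]).det = - sv 1 x := by
  rw [Matrix.det_succ_row_zero]
  simp [Fin.sum_univ_succ, Matrix.det_fin_three, qv, sv, Fin.succAbove, Pi.single_apply]
  ring

lemma det_qv_single_one_three (M : ℕ) (x : K) :
    (Matrix.of ![qv M x 0, qv M x 1, Pi.single 1 1, Pi.single 3 1]).det = - sv M x := by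
  rw [Matrix.det_succ_row_zero]
  simp [Fin.sum_univ_succ, Matrix.det_fin_three, qv, sv, Fin.succAbove, Pi.single_apply]
  ring

/-- Combines the collision and interpolation identities for an extra pair of columns `q'`
evaluated at all the points. -/
lemma exists_collision_sum {N R : ℕ} {B : Type*} [Fintype B] [DecidableEq B]
    (e : (Fin (N + 1) × Fin 2) ⊕ (Fin 2 ⊕ B) ≃ Fin (R + 1) × Fin 4)
    (e' : (Fin N × Fin 2) ⊕ B ≃ Fin R × Fin 4) :
    ∃ u : ℤˣ, ∀ (M : ℕ) (x : Fin (N + 1) → K), (Function.Injective fun i => yv (x i)) →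
      ∀ (q' : Fin 2 → Fin 4 → K) (b : B → Fin 4 → K) (c : K) (h : (Fin N → K) → K) (w : K → K)
      (g : Fin (R + 1) → Fin (R + 1) → K),
      (∀ j, (Matrix.of ![qv M (x j) 0, qv M (x j) 1, q' 0, q' 1]).det = w (x j)) →
      (∀ k k' : Fin (R + 1), g k k' = famDet e (Sum.elim (xpts (R + 1) M x)
        (Sum.elim ![blockVec k (q' 0), blockVec k' (q' 1)]
          (fun β => blockVec (Fin.last R) (b β))))) →
      (∀ k k' : Fin (R + 1), N < (k : ℕ) + k' → g k k' = 0) →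
      (∀ j : Fin (N + 1), famDet e' (Sum.elim (xpts R M fun k => x (j.succAbove k))
          (fun β => colVec R 1 0 (b β))) =
          c * yvDet (fun k => x (j.succAbove k)) * h (fun k => x (j.succAbove k))) →
      ∑ k : Fin (R + 1), ∑ k' : Fin (R + 1), (if (k : ℕ) + k' = N then g k k' else 0) =
        ((u : ℤ) : K) * c * yvDet x * ∑ j : Fin (N + 1), (-1) ^ (N + j : ℕ) * w (x j) *
          h (fun k => x (j.succAbove k)) := by
  obtain ⟨u, hu⟩ := point_collision (K := K) e e'
  refine ⟨u, fun M x hinj q' b c h w g hw hg hgz hrec => ?_⟩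
  have hG : ∀ j, famDet e (Sum.elim (xpts (R + 1) M x)
      (Sum.elim (fun ε => colVec (R + 1) (yv (x j)) 1 (q' ε))
        (fun β => blockVec (Fin.last R) (b β)))) = _ :=
    fun j => famDet_pair_expand e _ _ _ (yv (x j))
  have hsum := sum_vandermonde_interpolation (fun j => yv (x j)) g hgz
  simp only [hg] at hsum
  simp only [← hG] at hsum
  simp only [← hg] at hsum
  have hV : yvDet x ≠ 0 := yvDet_ne_zero hinj
  have hterm : ∀ j : Fin (N + 1),
      (-1) ^ (j : ℕ) * (vandermonde fun k => yv (x (j.succAbove k))).det *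
      famDet e (Sum.elim (xpts (R + 1) M x)
      (Sum.elim (fun ε => colVec (R + 1) (yv (x j)) 1 (q' ε))
        (fun β => blockVec (Fin.last R) (b β)))) =
      ((u : ℤ) : K) * c * yvDet x ^ 2 * ((-1) ^ (j : ℕ) * w (x j) *
          h (fun k => x (j.succAbove k))) := by
    intro j
    have hcol := hu (fun l => yv (x l)) (fun l => qv M (x l)) q' b j
    simp only [colVec_one_zero] at hcol
    have hr := hrec j
    unfold xpts at hr ⊢
    rw [hcol, hr, hw]
    have hv1 := det_vandermonde_eq_diffProd (fun l => yv (x l)) j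
    change yvDet x = _ * _ * yvDet (fun k => x (j.succAbove k)) at hv1
    change _ * yvDet (fun k => x (j.succAbove k)) * _ = _
    rw [hv1]
    have hs : ((-1 : K) ^ (j : ℕ)) * (-1) ^ (j : ℕ) = 1 := by rw [← mul_pow]; simp
    generalize ((-1 : K) ^ (j : ℕ)) = sj at *
    linear_combination (- sj * w (x j) * yvDet (fun k => x (j.succAbove k)) ^ 2 *
      diffProd (fun l => yv (x l)) j ^ 2 * ((u : ℤ) : K) * c *
      h (fun k => x (j.succAbove k))) * hs
  rw [Finset.sum_congr rfl fun j _ => hterm j, ← Finset.mul_sum] at hsum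
  change _ = _ * yvDet x * _ at hsum
  have hs : ((-1 : K) ^ N) * (-1) ^ N = 1 := by rw [← mul_pow]; simp
  have hout : ∑ j : Fin (N + 1), (-1 : K) ^ (N + j : ℕ) * w (x j) *
      h (fun k => x (j.succAbove k)) = (-1) ^ N * ∑ j : Fin (N + 1), (-1) ^ (j : ℕ) * w (x j) *
      h (fun k => x (j.succAbove k)) := by
    rw [Finset.mul_sum]
    refine Finset.sum_congr rfl fun j _ => ?_
    ring
  rw [hout]
  apply mul_left_cancel₀ hV
  linear_combination (-(-1) ^ N) * hsum - yvDet x * (∑ k : Fin (R + 1), ∑ k' : Fin (R + 1),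
    (if (k : ℕ) + k' = N then g k k' else 0)) * hs

/-- The determinant of the points together with two unit columns at infinity is a Vandermonde
determinant times `pairSumOne`. -/
lemma exists_famDet_eq_pairSumOne [CharZero K] (r : ℕ)
    (e : (Fin (2 * r + 1) × Fin 2) ⊕ Fin 2 ≃ Fin (r + 1) × Fin 4) :
    ∃ c : K, c ≠ 0 ∧ ∀ (M : ℕ) (x : Fin (2 * r + 1) → K), (∀ i, x i ≠ 0) →
      (Function.Injective fun i => yv (x i)) →
        famDet e (Sum.elim (xpts (r + 1) M x) (fun ε => blockVec (Fin.last r)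
          ((![Pi.single 0 1, Pi.single 1 1] : Fin 2 → Fin 4 → K) ε))) =
          c * yvDet x * pairSumOne M r x := by
  have e₀ : (Fin (2 * r) × Fin 2) ⊕ Fin 0 ≃ Fin r × Fin 4 :=
    Fintype.equivOfCardEq (by simp; ring)
  let σ : (Fin (2 * r + 1) × Fin 2) ⊕ (Fin 2 ⊕ Fin 0) ≃ (Fin (2 * r + 1) × Fin 2) ⊕ Fin 2 :=
    (Equiv.refl _).sumCongr (Equiv.sumEmpty _ _)
  obtain ⟨c, hc, hrec⟩ := exists_famDet_eq_pairSum (K := K) r e₀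
  obtain ⟨u₁, h₁⟩ := exists_famDet_eq (K := K) e (σ.trans e) σ
  obtain ⟨u, hu⟩ := exists_collision_sum (K := K) (σ.trans e) e₀
  refine ⟨-(((u₁ : ℤ) : K) * ((u : ℤ) : K) * c), neg_ne_zero.mpr
    (mul_ne_zero (mul_ne_zero (intUnit_ne_zero u₁) (intUnit_ne_zero u)) hc),
    fun M x hx hinj => ?_⟩
  have h := hu M x hinj ![Pi.single 0 1, Pi.single 1 1] (fun β => Fin.elim0 β) c
    (pairSum M r) (fun z => - sv 1 z) _ (fun j => det_qv_single_zero_one M (x j))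
    (fun _ _ => rfl) (fun k k' hk => absurd hk (by omega)) (fun j => by
      rw [← hrec M _ (fun k => hx _) (injective_comp_succAbove hinj j)]
      congr 2
      exact Subsingleton.elim _ _)
  rw [Finset.sum_eq_single (Fin.last r) (fun k _ hk => Finset.sum_eq_zero fun k' _ =>
      if_neg (fun hkk => hk (Fin.ext (by simp only [Fin.val_last]; omega)))) (by simp),
    Finset.sum_eq_single (Fin.last r) (fun k' _ hk =>
      if_neg (fun hkk => hk (Fin.ext (by simp only [Fin.val_last] at *; omega)))) (by simp),
    if_pos (by simp; ring)] at h
  rw [h₁]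
  have hf : (fun c => Sum.elim (xpts (r + 1) M x) (fun ε => blockVec (Fin.last r)
          ((![Pi.single 0 1, Pi.single 1 1] : Fin 2 → Fin 4 → K) ε)) (σ c)) =
      Sum.elim (xpts (r + 1) M x)
        (Sum.elim ![blockVec (Fin.last r) ((![Pi.single 0 1, Pi.single 1 1] :
            Fin 2 → Fin 4 → K) 0), blockVec (Fin.last r) ((![Pi.single 0 1, Pi.single 1 1] :
            Fin 2 → Fin 4 → K) 1)]
          (fun β => blockVec (Fin.last r) (Fin.elim0 β))) := by
    funext c
    rcases c with p | ε | β
    · rfl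
    · fin_cases ε <;> rfl
    · exact β.elim0
  rw [hf, h]
  unfold pairSumOne
  simp only [svDet_snoc]
  rw [Finset.sum_comm]
  simp only [pairSum, Finset.mul_sum]
  refine Finset.sum_congr rfl fun j _ => Finset.sum_congr rfl fun s _ => ?_
  ring

/-- The determinant of the points together with two unit columns at infinity and two further
unit columns is a Vandermonde determinant times `pairSumTop`. -/
lemma exists_famDet_eq_pairSumTop [CharZero K] (r : ℕ)
    (e : (Fin (2 * r + 2) × Fin 2) ⊕ (Fin 2 ⊕ Fin 2) ≃ Fin (r + 2) × Fin 4) :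
    ∃ c : K, c ≠ 0 ∧ ∀ (M : ℕ) (x : Fin (2 * r + 2) → K), (∀ i, x i ≠ 0) →
      (Function.Injective fun i => yv (x i)) →
        famDet e (Sum.elim (xpts (r + 2) M x) (Sum.elim
          ![blockVec (Fin.last r).castSucc (Pi.single 1 1),
            blockVec (Fin.last (r + 1)) (Pi.single 3 1)]
          (fun ε => blockVec (Fin.last (r + 1))
          ((![Pi.single 0 1, Pi.single 1 1] : Fin 2 → Fin 4 → K) ε)))) =
          c * yvDet x * pairSumTop M r x := by
  have e₀ : (Fin (2 * r + 1) × Fin 2) ⊕ Fin 2 ≃ Fin (r + 1) × Fin 4 :=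
    Fintype.equivOfCardEq (by simp; ring)
  obtain ⟨c, hc, hrec⟩ := exists_famDet_eq_pairSumOne (K := K) r e₀
  obtain ⟨u, hu⟩ := exists_collision_sum (K := K) e e₀
  refine ⟨((u : ℤ) : K) * c, mul_ne_zero (intUnit_ne_zero u) hc, fun M x hx hinj => ?_⟩
  have hdup : ∀ k' : Fin (r + 2), famDet e (Sum.elim (xpts (r + 1 + 1) M x)
        (Sum.elim ![blockVec (Fin.last (r + 1)) ((![Pi.single 1 1, Pi.single 3 1] :
            Fin 2 → Fin 4 → K) 0), blockVec k' ((![Pi.single 1 1, Pi.single 3 1] :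
            Fin 2 → Fin 4 → K) 1)] (fun ε => blockVec (Fin.last (r + 1))
          ((![Pi.single 0 1, Pi.single 1 1] : Fin 2 → Fin 4 → K) ε)))) = 0 := fun k' =>
    famDet_eq_zero e _ (c := Sum.inr (Sum.inl 0)) (c' := Sum.inr (Sum.inr 1)) (by simp) (by simp)
  have h := hu M x hinj ![Pi.single 1 1, Pi.single 3 1] ![Pi.single 0 1, Pi.single 1 1] c
    (pairSumOne M r) (fun z => - sv M z) _ (fun j => det_qv_single_one_three M (x j))
    (fun _ _ => rfl) (fun k k' hk => by
      have : k = Fin.last (r + 1) := Fin.ext (by simp only [Fin.val_last]; omega)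
      rw [this]
      exact hdup k') (fun j => by
      rw [← hrec M _ (fun k => hx _) (injective_comp_succAbove hinj j)]
      simp only [colVec_one_zero])
  rw [Fin.sum_univ_castSucc, Finset.sum_eq_zero (s := Finset.univ)
      (f := fun k' : Fin (r + 2) => if ((Fin.last (r + 1) : Fin (r + 2)) : ℕ) + k' = _ then _
        else _) (fun k' _ => by rw [hdup]; simp), add_zero,
    Finset.sum_eq_single (Fin.last r) (fun k _ hk => Finset.sum_eq_zero fun k' _ =>
      if_neg (fun hkk => hk (Fin.ext (by simp only [Fin.val_last, Fin.val_castSucc] at *; omega))))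
      (by simp),
    Finset.sum_eq_single (Fin.last (r + 1)) (fun k' _ hk =>
      if_neg (fun hkk => hk (Fin.ext (by
        simp only [Fin.val_last, Fin.val_castSucc] at *; omega)))) (by simp),
    if_pos (by simp; ring)] at h
  refine Eq.trans h ?_
  unfold pairSumTop
  simp only [svDet_cons]
  rw [Finset.sum_comm]
  simp only [pairSumOne, Finset.mul_sum]
  refine Finset.sum_congr rfl fun j _ => Finset.sum_congr rfl fun s _ => ?_
  have : (-1 : K) ^ (2 * r + 1 + j : ℕ) = - (-1) ^ (j : ℕ) := by
    rw [pow_add, pow_succ, pow_mul]; simp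
  rw [this]
  ring

end BackgroundLevels

section RectangularAlternant

variable {K : Type*} [Field K]

/-- The variables `x₀, x₀⁻¹, x₁, x₁⁻¹, …`. -/
def zpts {n : ℕ} (x : Fin n → K) : Fin (2 * n) → K := fun j =>
  if (j : ℕ) % 2 = 0 then x ⟨(j : ℕ) / 2, by have := j.isLt; omega⟩
  else (x ⟨(j : ℕ) / 2, by have := j.isLt; omega⟩)⁻¹

/-- The exponents of the alternant of the rectangular shape `(m ^ (n - 1))`. -/
def rectExp (n m : ℕ) (i : Fin (2 * n)) : ℤ :=
  (if (i : ℕ) < n - 1 then (m : ℤ) else 0) + ((2 * n : ℕ) : ℤ) - 1 - (i : ℕ)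

/-- The alternant of the rectangular shape `(m ^ (n - 1))` in the variables `zpts x`. -/
def rectNum (n m : ℕ) (x : Fin n → K) : K :=
  Matrix.det (Matrix.of fun i j : Fin (2 * n) => zpts x j ^ rectExp n m i)

/-- The identification `2 i + ε ↔ (i, ε)`. -/
def divModEquiv (n : ℕ) : Fin (2 * n) ≃ Fin n × Fin 2 where
  toFun j := (⟨(j : ℕ) / 2, by have := j.isLt; omega⟩, ⟨(j : ℕ) % 2, by omega⟩)
  invFun p := ⟨2 * (p.1 : ℕ) + p.2, by have := p.1.isLt; have := p.2.isLt; omega⟩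
  left_inv j := by ext; simp; omega
  right_inv p := by
    have := p.2.isLt
    ext <;> simp <;> omega

lemma prod_zpts {n : ℕ} {x : Fin n → K} (hx : ∀ i, x i ≠ 0) : ∏ j, zpts x j = 1 := by
  rw [← Equiv.prod_comp (divModEquiv n).symm, Fintype.prod_prod_type]
  refine Finset.prod_eq_one fun i _ => ?_
  rw [Fin.prod_univ_two]
  have h : ∀ ε : Fin 2, zpts x ((divModEquiv n).symm (i, ε)) =
      if (ε : ℕ) = 0 then x i else (x i)⁻¹ := by
    intro ε
    have hε := ε.isLt
    have h1 : (⟨(2 * (i : ℕ) + ε) / 2, by have := i.isLt; omega⟩ : Fin n) = i :=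
      Fin.ext (by simp; omega)
    have h2 : (2 * (i : ℕ) + ε) % 2 = ε := by omega
    simp only [zpts, divModEquiv, Equiv.coe_fn_symm_mk, h1, h2]
  rw [h, h]
  simp [hx i]

lemma zpts_ne_zero {n : ℕ} {x : Fin n → K} (hx : ∀ i, x i ≠ 0) (j : Fin (2 * n)) :
    zpts x j ≠ 0 := by
  unfold zpts
  split_ifs
  · exact hx _
  · exact inv_ne_zero (hx _)

lemma xpts_divModEquiv {n R M : ℕ} (x : Fin n → K) (j : Fin (2 * n)) (p : Fin R × Fin 4) :
    xpts R M x (divModEquiv n j) p = (zpts x j + (zpts x j)⁻¹) ^ (p.1 : ℕ) *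
      (![zpts x j ^ M, zpts x j ^ (M + 1), 1, zpts x j] : Fin 4 → K) p.2 := by
  simp only [xpts, pts, colVec, one_pow, mul_one, divModEquiv, Equiv.coe_fn_mk, zpts, yv]
  rcases Nat.mod_two_eq_zero_or_one (j : ℕ) with h | h
  · simp [h, qv]
  · simp only [h, qv, one_ne_zero, if_false, inv_inv]
    rw [add_comm]
    rfl

/-- Laurent monomials times powers of `z + z⁻¹` are combinations of Laurent monomials, with
coefficients independent of a shift of the exponents. -/
lemma exists_coeff_pow_mul_zpow {D : Type*} [Fintype D] [DecidableEq D] (a : ℕ → D → ℤ) (k : ℕ) :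
    ∀ b : ℕ → ℤ, (∀ j : ℤ, |j| ≤ k → ∃ d, ∀ m, a m d = b m + j) →
      ∃ T : D → K, ∀ m (z : K), z ≠ 0 →
        (z + z⁻¹) ^ k * z ^ b m = ∑ d, z ^ a m d * T d := by
  induction k with
  | zero =>
    intro b hb
    obtain ⟨d, hd⟩ := hb 0 (by simp)
    refine ⟨Pi.single d 1, fun m z _ => ?_⟩
    simp [Pi.single_apply, hd]
  | succ k ih =>
    intro b hb
    obtain ⟨T₁, h₁⟩ := ih (fun m => b m + 1) (fun j hj => by
      obtain ⟨d, hd⟩ := hb (1 + j) (by push_cast; rw [abs_le] at *; constructor <;> omega)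
      exact ⟨d, fun m => by rw [hd]; ring⟩)
    obtain ⟨T₂, h₂⟩ := ih (fun m => b m - 1) (fun j hj => by
      obtain ⟨d, hd⟩ := hb (-1 + j) (by push_cast; rw [abs_le] at *; constructor <;> omega)
      exact ⟨d, fun m => by rw [hd]; ring⟩)
    refine ⟨fun d => T₁ d + T₂ d, fun m z hz => ?_⟩
    simp only [mul_add, Finset.sum_add_distrib]
    rw [← h₁ m z hz, ← h₂ m z hz, zpow_add₀ hz, zpow_sub₀ hz, zpow_one, pow_succ]
    ring

lemma exists_famDet_eq_rectNum {n R : ℕ} {B : Type*} [Fintype B] [DecidableEq B]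
    (e : (Fin n × Fin 2) ⊕ B ≃ Fin R × Fin 4) (bg : B → Fin R × Fin 4) (M : ℕ → ℕ) (s : ℤ)
    (hbg : ∀ p : Fin R × Fin 4, p ∉ Set.range bg → ∀ j : ℤ, |j| ≤ (p.1 : ℕ) →
      ∃ d : Fin (2 * n), ∀ m, rectExp n m d - s =
        (![(M m : ℤ), (M m : ℤ) + 1, 0, 1] : Fin 4 → ℤ) p.2 + j)
    (hinj : Function.Injective bg) :
    ∃ t : K, ∀ (m : ℕ) (x : Fin n → K), (∀ i, x i ≠ 0) →
      famDet e (Sum.elim (xpts R (M m) x) (fun β => Pi.single (bg β) 1)) =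
        t * rectNum n m x := by
  have hT : ∀ p : Fin R × Fin 4, ∃ T : Fin (2 * n) → K, p ∉ Set.range bg →
      ∀ m (z : K), z ≠ 0 → (z + z⁻¹) ^ (p.1 : ℕ) *
        (![z ^ M m, z ^ (M m + 1), 1, z] : Fin 4 → K) p.2 =
          ∑ d, z ^ (rectExp n m d - s) * T d := by
    intro p
    by_cases hp : p ∈ Set.range bg
    · exact ⟨0, fun h => absurd hp h⟩
    · obtain ⟨T, h⟩ := exists_coeff_pow_mul_zpow (K := K) (fun m d => rectExp n m d - s) p.1
        (fun m => (![(M m : ℤ), (M m : ℤ) + 1, 0, 1] : Fin 4 → ℤ) p.2) (hbg p hp)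
      refine ⟨T, fun _ m z hz => ?_⟩
      rw [← h m z hz]
      congr 1
      obtain ⟨k, t⟩ := p
      fin_cases t
      · simp
      · simp only [Fin.mk_one, Matrix.cons_val_one, Matrix.cons_val_zero]
        exact_mod_cast rfl
      · simp
      · simp
  choose T hT using hT
  let ψ : Fin (2 * n) ⊕ B ≃ (Fin n × Fin 2) ⊕ B := (divModEquiv n).sumCongr (Equiv.refl B)
  let T' : Matrix (Fin (2 * n) ⊕ B) (Fin (2 * n) ⊕ B) K := Matrix.of fun d c =>
    Sum.elim (fun d => if e (ψ c) ∈ Set.range bg then 0 else T (e (ψ c)) d)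
      (fun β => (Pi.single (bg β) 1 : Fin R × Fin 4 → K) (e (ψ c))) d
  refine ⟨T'.det, fun m x hx => ?_⟩
  have hfac : (Matrix.of fun c c' => Sum.elim (xpts R (M m) x) (fun β => Pi.single (bg β) 1)
      (ψ c) (e (ψ c'))) = Matrix.fromBlocks
        (Matrix.of fun j d : Fin (2 * n) => zpts x j ^ (rectExp n m d - s))
        (Matrix.of fun j β => xpts R (M m) x (divModEquiv n j) (bg β)) 0 1 * T' := by
    ext c c'
    rw [Matrix.mul_apply, Fintype.sum_sum_type]
    rcases c with j | β
    · change xpts R (M m) x (divModEquiv n j) (e (ψ c')) = ∑ d, zpts x j ^ (rectExp n m d - s) *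
        (if e (ψ c') ∈ Set.range bg then 0 else T (e (ψ c')) d) +
        ∑ β, xpts R (M m) x (divModEquiv n j) (bg β) *
          (Pi.single (bg β) 1 : Fin R × Fin 4 → K) (e (ψ c'))
      by_cases hp : e (ψ c') ∈ Set.range bg
      · obtain ⟨β, hβ⟩ := hp
        simp only [← hβ, Set.mem_range_self, if_true, mul_zero, Finset.sum_const_zero, zero_add]
        rw [Finset.sum_eq_single β]
        · simp
        · intro β' _ hne
          rw [Pi.single_eq_of_ne (fun h => hne (hinj h).symm), mul_zero]
        · simp
      · simp only [hp, if_false]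
        rw [Finset.sum_eq_zero (s := (Finset.univ : Finset B)), add_zero, xpts_divModEquiv,
          hT _ hp m _ (zpts_ne_zero hx j)]
        intro β _
        rw [Pi.single_eq_of_ne (fun h => hp ⟨β, h.symm⟩), mul_zero]
    · change (Pi.single (bg β) 1 : Fin R × Fin 4 → K) (e (ψ c')) =
        ∑ d, (0 : K) * _ + ∑ β', (1 : Matrix B B K) β β' *
          (Pi.single (bg β') 1 : Fin R × Fin 4 → K) (e (ψ c'))
      rw [Finset.sum_eq_single β]
      · simp
      · intro β' _ hne
        rw [Matrix.one_apply_ne hne.symm, zero_mul]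
      · simp
  unfold famDet
  rw [← Matrix.det_submatrix_equiv_self ψ]
  change Matrix.det (Matrix.of fun c c' => Sum.elim (xpts R (M m) x)
    (fun β => Pi.single (bg β) 1) (ψ c) (e (ψ c'))) = _
  rw [hfac, Matrix.det_mul, Matrix.det_fromBlocks_zero₂₁, Matrix.det_one, mul_one, mul_comm]
  congr 1
  have hcol : (Matrix.of fun j d : Fin (2 * n) => zpts x j ^ (rectExp n m d - s)) =
      Matrix.of fun j d => zpts x j ^ (-s) *
        (Matrix.of fun i j : Fin (2 * n) => zpts x j ^ rectExp n m i)ᵀ j d := by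
    ext j d
    simp only [of_apply, transpose_apply]
    rw [← zpow_add₀ (zpts_ne_zero hx j)]
    congr 1
    ring
  rw [hcol, Matrix.det_mul_column, Matrix.det_transpose, Finset.prod_zpow, prod_zpts hx, _root_.one_zpow,
    one_mul]
  rfl

lemma blockVec_single {R : ℕ} (k : Fin R) (t : Fin 4) :
    blockVec (K := K) k (Pi.single t 1) = Pi.single (k, t) 1 := by
  funext p
  simp only [blockVec, Pi.single_apply, Prod.ext_iff]
  split_ifs <;> simp_all

lemma exists_rectNum_eq_pairSumOne [CharZero K] (r : ℕ) :
    ∃ t c : K, c ≠ 0 ∧ ∀ (m : ℕ) (x : Fin (2 * r + 1) → K), (∀ i, x i ≠ 0) →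
      (Function.Injective fun i => yv (x i)) →
        t * rectNum (2 * r + 1) m x = c * yvDet x * pairSumOne (m + 2 * r + 1) r x := by
  have e : (Fin (2 * r + 1) × Fin 2) ⊕ Fin 2 ≃ Fin (r + 1) × Fin 4 :=
    Fintype.equivOfCardEq (by simp; ring)
  obtain ⟨c, hc, h⟩ := exists_famDet_eq_pairSumOne (K := K) r e
  obtain ⟨t, ht⟩ := exists_famDet_eq_rectNum (K := K) e
    (fun ε => (Fin.last r, (![0, 1] : Fin 2 → Fin 4) ε)) (fun m => m + 2 * r + 1) r (by
      rintro ⟨k, i⟩ hp j hj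
      rw [abs_le] at hj
      have hk := k.isLt
      have hlast : (i = 0 ∨ i = 1) → (k : ℕ) < r := by
        intro hi
        by_contra hlt
        have hkl : k = Fin.last r := Fin.ext (by simp only [Fin.val_last]; omega)
        apply hp
        rcases hi with rfl | rfl
        · exact ⟨0, by simp [hkl]⟩
        · exact ⟨1, by simp [hkl]⟩
      simp only at hj
      fin_cases i
      · have := hlast (by simp)
        obtain ⟨d, hd⟩ := Int.eq_ofNat_of_zero_le (a := r - j) (by omega)
        refine ⟨⟨d, by omega⟩, fun m => ?_⟩
        have hlt : d < 2 * r + 1 - 1 := by omega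
        simp only [rectExp, hlt, if_true]
        simp
        omega
      · have := hlast (by simp)
        obtain ⟨d, hd⟩ := Int.eq_ofNat_of_zero_le (a := r - 1 - j) (by omega)
        refine ⟨⟨d, by omega⟩, fun m => ?_⟩
        have hlt : d < 2 * r + 1 - 1 := by omega
        simp only [rectExp, hlt, if_true]
        simp
        omega
      · obtain ⟨d, hd⟩ := Int.eq_ofNat_of_zero_le (a := 3 * r + 1 - j) (by omega)
        refine ⟨⟨d, by omega⟩, fun m => ?_⟩
        have hlt : ¬ d < 2 * r + 1 - 1 := by omega
        simp only [rectExp, hlt, if_false]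
        simp
        omega
      · obtain ⟨d, hd⟩ := Int.eq_ofNat_of_zero_le (a := 3 * r - j) (by omega)
        refine ⟨⟨d, by omega⟩, fun m => ?_⟩
        have hlt : ¬ d < 2 * r + 1 - 1 := by omega
        simp only [rectExp, hlt, if_false]
        simp
        omega) (by
      intro a b hab
      fin_cases a <;> fin_cases b <;> simp_all)
  refine ⟨t, c, hc, fun m x hx hinj => ?_⟩
  rw [← ht m x hx, ← h _ x hx hinj]
  congr 2
  funext ε
  rw [← blockVec_single]
  congr 1
  fin_cases ε <;> rfl

lemma exists_rectNum_eq_pairSumTop [CharZero K] (r : ℕ) :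
    ∃ t c : K, c ≠ 0 ∧ ∀ (m : ℕ) (x : Fin (2 * r + 2) → K), (∀ i, x i ≠ 0) →
      (Function.Injective fun i => yv (x i)) →
        t * rectNum (2 * r + 2) m x = c * yvDet x * pairSumTop (m + 2 * r + 2) r x := by
  have e : (Fin (2 * r + 2) × Fin 2) ⊕ (Fin 2 ⊕ Fin 2) ≃ Fin (r + 2) × Fin 4 :=
    Fintype.equivOfCardEq (by simp; ring)
  obtain ⟨c, hc, h⟩ := exists_famDet_eq_pairSumTop (K := K) r e
  obtain ⟨t, ht⟩ := exists_famDet_eq_rectNum (K := K) e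
    (Sum.elim ![((Fin.last r).castSucc, 1), (Fin.last (r + 1), 3)]
      (fun ε => (Fin.last (r + 1), (![0, 1] : Fin 2 → Fin 4) ε))) (fun m => m + 2 * r + 2)
    (r + 1) (by
      rintro ⟨k, i⟩ hp j hj
      rw [abs_le] at hj
      have hk := k.isLt
      have hlast : (i = 0 ∨ i = 1 ∨ i = 3) → (k : ℕ) < r + 1 := by
        intro hi
        by_contra hlt
        have hkl : k = Fin.last (r + 1) := Fin.ext (by simp only [Fin.val_last]; omega)
        apply hp
        rcases hi with rfl | rfl | rfl
        · exact ⟨Sum.inr 0, by simp [hkl]⟩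
        · exact ⟨Sum.inr 1, by simp [hkl]⟩
        · exact ⟨Sum.inl 1, by simp [hkl]⟩
      have hone : i = 1 → (k : ℕ) < r := by
        intro hi
        have h1 := hlast (Or.inr (Or.inl hi))
        by_contra hlt
        have hkl : k = (Fin.last r).castSucc :=
          Fin.ext (by simp only [Fin.val_last, Fin.val_castSucc]; omega)
        exact hp ⟨Sum.inl 0, by simp [hkl, hi]⟩
      simp only at hj
      fin_cases i
      · have := hlast (by simp)
        obtain ⟨d, hd⟩ := Int.eq_ofNat_of_zero_le (a := r - j) (by omega)
        refine ⟨⟨d, by omega⟩, fun m => ?_⟩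
        have hlt : d < 2 * r + 2 - 1 := by omega
        simp only [rectExp, hlt, if_true]
        simp
        omega
      · have := hone (by simp)
        obtain ⟨d, hd⟩ := Int.eq_ofNat_of_zero_le (a := r - 1 - j) (by omega)
        refine ⟨⟨d, by omega⟩, fun m => ?_⟩
        have hlt : d < 2 * r + 2 - 1 := by omega
        simp only [rectExp, hlt, if_true]
        simp
        omega
      · obtain ⟨d, hd⟩ := Int.eq_ofNat_of_zero_le (a := 3 * r + 2 - j) (by omega)
        refine ⟨⟨d, by omega⟩, fun m => ?_⟩
        have hlt : ¬ d < 2 * r + 2 - 1 := by omega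
        simp only [rectExp, hlt, if_false]
        simp
        omega
      · have := hlast (by simp)
        obtain ⟨d, hd⟩ := Int.eq_ofNat_of_zero_le (a := 3 * r + 1 - j) (by omega)
        refine ⟨⟨d, by omega⟩, fun m => ?_⟩
        have hlt : ¬ d < 2 * r + 2 - 1 := by omega
        simp only [rectExp, hlt, if_false]
        simp
        omega) (by
      have hne : ((Fin.last r).castSucc : Fin (r + 2)) ≠ Fin.last (r + 1) :=
        (Fin.castSucc_lt_last _).ne
      rintro (a | a) (b | b) hab <;> fin_cases a <;> fin_cases b <;>
        simp_all [Prod.ext_iff, hne.symm])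
  refine ⟨t, c, hc, fun m x hx hinj => ?_⟩
  rw [← ht m x hx, ← h _ x hx hinj]
  congr 2
  funext β
  rcases β with ε | ε
  · fin_cases ε <;> exact (blockVec_single _ _).symm
  · rw [← blockVec_single]
    simp only [Sum.elim_inr]
    congr 1
    fin_cases ε <;> rfl

end RectangularAlternant

section Sorting

lemma sum_eq_factorial_mul_sum_strictAnti {K α : Type*} [Field K] [LinearOrder α] [Fintype α]
    {r : ℕ} (f : (Fin r → α) → K) (hperm : ∀ s (σ : Equiv.Perm (Fin r)), f (s ∘ σ) = f s)
    (hzero : ∀ s, ¬ Function.Injective s → f s = 0) :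
    ∑ s, f s = (r.factorial : K) * ∑ s ∈ Finset.univ.filter StrictAnti, f s := by
  have h1 : ∑ p ∈ (Finset.univ : Finset (Equiv.Perm (Fin r))) ×ˢ
      (Finset.univ.filter (StrictAnti : (Fin r → α) → Prop)), f p.2 = ∑ s, f s := by
    refine Finset.sum_of_injOn (fun p => p.2 ∘ p.1) ?_ (fun _ _ => Finset.mem_coe.mpr (Finset.mem_univ _)) ?_ ?_
    · rintro ⟨σ, s⟩ hs ⟨σ', s'⟩ hs' h
      simp only [Finset.coe_product, Set.mem_prod, Finset.mem_coe, Finset.mem_filter,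
        Finset.mem_univ, true_and] at hs hs' h
      have hr : Set.range s = Set.range s' := by
        rw [← σ.surjective.range_comp s, h, σ'.surjective.range_comp]
      have hss : s = s' := by
        have := (StrictMono.range_inj (f := OrderDual.toDual ∘ s) (g := OrderDual.toDual ∘ s')
          hs.dual_right hs'.dual_right).mp (by rw [Set.range_comp, Set.range_comp, hr])
        funext i
        exact congrFun this i
      subst hss
      have : σ = σ' := by
        ext i
        exact congrArg Fin.val (hs.injective (congrFun h i))
      rw [this]
    · intro s _ hs
      apply hzero
      intro hinj
      apply hs
      refine ⟨((Fin.revPerm.trans (Tuple.sort s)).symm, s ∘ (Tuple.sort s) ∘ Fin.rev), ?_, ?_⟩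
      · simp only [Finset.coe_product, Set.mem_prod, Finset.mem_coe, Finset.mem_filter,
          Finset.mem_univ, true_and]
        have hm := (Tuple.monotone_sort s).strictMono_of_injective
          (hinj.comp (Tuple.sort s).injective)
        exact fun a b hab => hm (Fin.rev_lt_rev.mpr hab)
      · funext i
        simp [Function.comp]
    · rintro ⟨σ, s⟩ _
      exact (hperm s σ).symm
  rw [← h1, Finset.sum_product]
  simp [Fintype.card_perm]

end Sorting

section RowExponents

variable {K : Type*} [Field K]

/-- The row exponents `l₀ + 1, l₀, l₁ + 1, l₁, …, 1`, preceded by `M` when `δ = 1`. -/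
def extRows {r : ℕ} (δ M : ℕ) (l : Fin r → ℕ) (j : ℕ) : ℕ :=
  if j < δ then M else if h : (j - δ) / 2 < r then l ⟨(j - δ) / 2, h⟩ + 1 - (j - δ) % 2 else 1

lemma extRows_even {r δ M j : ℕ} (l : Fin r → ℕ) (i : Fin r) (h : j = 2 * i + δ) :
    extRows δ M l j = l i + 1 := by
  subst h
  simp [extRows]

lemma extRows_odd {r δ M j : ℕ} (l : Fin r → ℕ) (i : Fin r) (h : j = 2 * i + 1 + δ) :
    extRows δ M l j = l i := by
  subst h
  have h1 : (2 * (i : ℕ) + 1) / 2 = i := by omega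
  simp [extRows, h1]

lemma extRows_last {r δ M j : ℕ} (l : Fin r → ℕ) (h : j = 2 * r + δ) :
    extRows δ M l j = 1 := by
  subst h
  simp [extRows]

lemma extRows_top {r δ M j : ℕ} (l : Fin r → ℕ) (h : j < δ) : extRows δ M l j = M := by
  simp [extRows, h]

lemma snoc_pairRows {r : ℕ} (M : ℕ) (l : Fin r → ℕ) :
    (Fin.snoc (α := fun _ => ℕ) (pairRows l) 1 : Fin (2 * r + 1) → ℕ) =
      fun j : Fin (2 * r + 1) => extRows 0 M l j := by
  funext j
  refine Fin.lastCases ?_ (fun j => ?_) j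
  · rw [Fin.snoc_last, extRows_last _ (by simp)]
  · have := j.isLt
    have h : (j : ℕ) / 2 < r := by omega
    simp [extRows, pairRows, h]

lemma cons_snoc_pairRows {r : ℕ} (M : ℕ) (l : Fin r → ℕ) :
    (Fin.cons (α := fun _ => ℕ) M (Fin.snoc (α := fun _ => ℕ) (pairRows l) 1) :
      Fin (2 * r + 2) → ℕ) = fun j : Fin (2 * r + 2) => extRows 1 M l j := by
  funext j
  refine Fin.cases ?_ (fun j => ?_) j
  · rw [Fin.cons_zero, extRows_top _ (by simp)]
  · rw [Fin.cons_succ, snoc_pairRows M]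
    simp [extRows]

/-- Splits the rows into pairs and the remaining rows. -/
lemma exists_pairEquiv {r δ n : ℕ} (hδ : δ ≤ 1) (hn : n = 2 * r + 1 + δ) :
    ∃ θ : (Fin r × Fin 2) ⊕ Fin (1 + δ) ≃ Fin n,
      (∀ i ε, (θ (Sum.inl (i, ε)) : ℕ) = 2 * i + ε + δ) ∧
      (∀ a, (θ (Sum.inr a) : ℕ) = if (a : ℕ) = 0 then 2 * r + δ else 0) := by
  let g : (Fin r × Fin 2) ⊕ Fin (1 + δ) → Fin n := Sum.elim
    (fun p => ⟨2 * p.1 + p.2 + δ, by have := p.1.isLt; have := p.2.isLt; omega⟩)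
    (fun a => ⟨if (a : ℕ) = 0 then 2 * r + δ else 0, by split_ifs <;> omega⟩)
  have hg : Function.Injective g := by
    rintro (⟨i, ε⟩ | a) (⟨i', ε'⟩ | a') h
    · have := congrArg Fin.val h
      simp only [g, Sum.elim_inl] at this
      have h1 : i = i' := Fin.ext (by omega)
      have h2 : ε = ε' := Fin.ext (by omega)
      rw [h1, h2]
    · have hh := congrArg Fin.val h
      have := i.isLt
      have := ε.isLt
      have := a'.isLt
      simp only [g, Sum.elim_inl, Sum.elim_inr] at hh
      split_ifs at hh <;> omega
    · have hh := congrArg Fin.val h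
      have := i'.isLt
      have := ε'.isLt
      have := a.isLt
      simp only [g, Sum.elim_inl, Sum.elim_inr] at hh
      split_ifs at hh <;> omega
    · have hh := congrArg Fin.val h
      have := a.isLt
      have := a'.isLt
      simp only [g, Sum.elim_inr] at hh
      have h1 : a = a' := Fin.ext (by split_ifs at hh <;> omega)
      rw [h1]
  exact ⟨Equiv.ofBijective g ((Fintype.bijective_iff_injective_and_card g).mpr
    ⟨hg, by simp; omega⟩), fun i ε => rfl, fun a => rfl⟩

lemma svDet_extRows_perm {r δ n M : ℕ} (hδ : δ ≤ 1) (hn : n = 2 * r + 1 + δ) (l : Fin r → ℕ)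
    (σ : Equiv.Perm (Fin r)) (x : Fin n → K) :
    svDet (fun j : Fin n => extRows δ M (l ∘ σ) j) x =
      svDet (fun j : Fin n => extRows δ M l j) x := by
  obtain ⟨θ, h1, h2⟩ := exists_pairEquiv hδ hn
  let π₀ : Equiv.Perm ((Fin r × Fin 2) ⊕ Fin (1 + δ)) :=
    (Equiv.prodCongrLeft (fun _ : Fin 2 => σ)).sumCongr (Equiv.refl _)
  have hs : Equiv.Perm.sign π₀ = 1 := by
    erw [Equiv.Perm.sign_sumCongr, Equiv.Perm.sign_prodCongrLeft]
    simp
  have h := svDet_perm (θ.permCongr π₀) (fun j : Fin n => extRows δ M l j) x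
  rw [Equiv.Perm.sign_permCongr, hs] at h
  simp only [Units.val_one, Int.cast_one, one_mul] at h
  rw [← h]
  congr 1
  funext j
  obtain ⟨c, rfl⟩ := θ.surjective j
  simp only [Equiv.permCongr_apply, Equiv.symm_apply_apply]
  rcases c with ⟨i, ε⟩ | a
  · have hπ : π₀ (Sum.inl (i, ε)) = Sum.inl (σ i, ε) := rfl
    rw [hπ]
    have hε : (ε : ℕ) = 0 ∨ (ε : ℕ) = 1 := by omega
    rcases hε with hε | hε
    · rw [extRows_even _ i (by rw [h1, hε]; rfl), extRows_even _ (σ i) (by rw [h1, hε]; rfl)]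
      rfl
    · rw [extRows_odd _ i (by rw [h1, hε]), extRows_odd _ (σ i) (by rw [h1, hε])]
      rfl
  · have hπ : π₀ (Sum.inr a) = Sum.inr a := rfl
    rw [hπ]
    by_cases ha : (a : ℕ) = 0
    · rw [extRows_last _ (by rw [h2, if_pos ha]), extRows_last _ (by rw [h2, if_pos ha])]
    · have hlt : (θ (Sum.inr a) : ℕ) < δ := by
        have := a.isLt
        rw [h2, if_neg ha]
        omega
      rw [extRows_top _ hlt, extRows_top _ hlt]

lemma svDet_eq_zero_of_eq {n : ℕ} {ρ : Fin n → ℕ} (x : Fin n → K) {i j : Fin n} (hij : i ≠ j)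
    (h : ρ i = ρ j) : svDet ρ x = 0 :=
  Matrix.det_zero_of_row_eq hij (by funext k; simp [h])

lemma svDet_eq_zero_of_zero {n : ℕ} {ρ : Fin n → ℕ} (x : Fin n → K) (i : Fin n)
    (h : ρ i = 0) : svDet ρ x = 0 :=
  Matrix.det_eq_zero_of_row_eq_zero i (by intro k; simp [h, sv])

end RowExponents

section PairedShapes

variable {K : Type*} [Field K]

/-- Partitions in the box `(m ^ n)` whose parts are equal in consecutive pairs, starting at the
row `δ`, with last part `0` and, when `δ = 1`, first part `m`. -/
def IsPaired {n m : ℕ} (δ : ℕ) (lam : Fin n → Fin (m + 1)) : Prop :=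
  (Antitone fun i => (lam i : ℕ)) ∧
    (∀ i j : Fin n, (i : ℕ) % 2 = δ → (j : ℕ) = i + 1 → (lam i : ℕ) = lam j) ∧
    (∀ i : Fin n, (i : ℕ) + 1 = n → (lam i : ℕ) = 0) ∧
    ∀ i : Fin n, (i : ℕ) < δ → (lam i : ℕ) = m

lemma row_cases {r δ n : ℕ} (hn : n = 2 * r + 1 + δ) (j : Fin n) :
    (∃ i : Fin r, (j : ℕ) = 2 * i + δ) ∨ (∃ i : Fin r, (j : ℕ) = 2 * i + 1 + δ) ∨
      (j : ℕ) = 2 * r + δ ∨ (j : ℕ) < δ := by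
  have hj := j.isLt
  by_cases h1 : (j : ℕ) < δ
  · exact Or.inr (Or.inr (Or.inr h1))
  by_cases h2 : (j : ℕ) = 2 * r + δ
  · exact Or.inr (Or.inr (Or.inl h2))
  have h3 : ((j : ℕ) - δ) / 2 < r := by omega
  rcases Nat.mod_two_eq_zero_or_one ((j : ℕ) - δ) with h | h
  · exact Or.inl ⟨⟨_, h3⟩, by simp only; omega⟩
  · exact Or.inr (Or.inl ⟨⟨_, h3⟩, by simp only; omega⟩)

/-- The row exponents attached to a paired shape. -/
def pairedRows {r δ n m : ℕ} (hn : n = 2 * r + 1 + δ) (lam : Fin n → Fin (m + 1)) (i : Fin r) :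
    Fin (m + n) :=
  ⟨lam ⟨2 * i + δ, by omega⟩ + 2 * (r - i), by
    have := (lam ⟨2 * i + δ, by omega⟩).isLt
    omega⟩

lemma extRows_pairedRows {r δ n m : ℕ} (hδ : δ ≤ 1) (hn : n = 2 * r + 1 + δ)
    {lam : Fin n → Fin (m + 1)} (h : IsPaired δ lam) (j : Fin n) :
    extRows δ (m + n) (fun i => (pairedRows hn lam i : ℕ)) j = lam j + n - j := by
  obtain ⟨-, h2, h3, h4⟩ := h
  rcases row_cases hn j with ⟨i, hi⟩ | ⟨i, hi⟩ | hi | hi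
  · rw [extRows_even _ i hi]
    have : (⟨2 * i + δ, by omega⟩ : Fin n) = j := Fin.ext hi.symm
    simp only [pairedRows, this]
    omega
  · rw [extRows_odd _ i hi]
    have := h2 ⟨2 * i + δ, by omega⟩ j (by simp only; omega) (by simp only; omega)
    simp only [pairedRows]
    omega
  · rw [extRows_last _ hi, h3 j (by omega)]
    omega
  · rw [extRows_top _ hi, h4 j hi]
    omega

lemma strictAnti_pairedRows {r δ n m : ℕ} (hn : n = 2 * r + 1 + δ)
    {lam : Fin n → Fin (m + 1)} (h : IsPaired δ lam) : StrictAnti (pairedRows hn lam) := by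
  intro a b hab
  have h1 := h.1 (show (⟨2 * a + δ, by omega⟩ : Fin n) ≤ ⟨2 * b + δ, by omega⟩ by
    simp only [Fin.mk_le_mk]; omega)
  simp only [pairedRows, Fin.mk_lt_mk]
  simp only at h1
  omega

lemma exists_pairedRows_eq {r δ n m : ℕ} (hδ : δ ≤ 1) (hn : n = 2 * r + 1 + δ) (x : Fin n → K)
    {s : Fin r → Fin (m + n)} (hs : StrictAnti s)
    (hne : svDet (fun j : Fin n => extRows δ (m + n) (fun i => (s i : ℕ)) j) x ≠ 0) :
    ∃ lam : Fin n → Fin (m + 1), IsPaired δ lam ∧ pairedRows hn lam = s := by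
  set ρ := extRows δ (m + n) (fun i => (s i : ℕ)) with hρ
  have hdist : ∀ a b, a < n → b < n → a ≠ b → ρ a ≠ ρ b := fun a b ha hb hab h =>
    hne (svDet_eq_zero_of_eq x (i := ⟨a, ha⟩) (j := ⟨b, hb⟩)
      (fun h => hab (congrArg Fin.val h)) h)
  have hpos : ∀ a, a < n → ρ a ≠ 0 := fun a ha h => hne (svDet_eq_zero_of_zero x ⟨a, ha⟩ h)
  have heven : ∀ i : Fin r, ρ (2 * i + δ) = s i + 1 := fun i => extRows_even _ i rfl
  have hodd : ∀ i : Fin r, ρ (2 * i + 1 + δ) = s i := fun i => extRows_odd _ i rfl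
  have hlast : ρ (2 * r + δ) = 1 := extRows_last _ rfl
  have htop : ∀ j, j < δ → ρ j = m + n := fun j hj => extRows_top _ hj
  have hstep : ∀ j, j + 1 < n → ρ (j + 1) < ρ j := by
    intro j hj
    have hd := hdist j (j + 1) (by omega) hj (by omega)
    have hp := hpos j (by omega)
    rcases row_cases hn ⟨j, by omega⟩ with ⟨i, hi⟩ | ⟨i, hi⟩ | hi | hi
    · simp only at hi
      have e1 : ρ j = s i + 1 := by rw [hi]; exact heven i
      have e2 : ρ (j + 1) = s i := by
        rw [hi, show 2 * (i : ℕ) + δ + 1 = 2 * i + 1 + δ by ring]; exact hodd i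
      omega
    · simp only at hi
      have e1 : ρ j = s i := by rw [hi]; exact hodd i
      by_cases hir : (i : ℕ) + 1 < r
      · have e2 : ρ (j + 1) = s ⟨i + 1, hir⟩ + 1 := by
          rw [hi, show 2 * (i : ℕ) + 1 + δ + 1 = 2 * (i + 1) + δ by ring]
          exact heven ⟨i + 1, hir⟩
        have := hs (show i < ⟨i + 1, hir⟩ from Nat.lt_succ_self _)
        have : (s ⟨i + 1, hir⟩ : ℕ) < s i := this
        omega
      · have e2 : ρ (j + 1) = 1 := by
          rw [hi, show 2 * (i : ℕ) + 1 + δ + 1 = 2 * r + δ by have := i.isLt; omega]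
          exact hlast
        omega
    · simp only at hi
      omega
    · simp only at hi
      have e1 := htop j hi
      by_cases hr : 0 < r
      · have e2 : ρ (j + 1) = s ⟨0, hr⟩ + 1 := by
          rw [show j + 1 = 2 * 0 + δ by omega]
          exact heven ⟨0, hr⟩
        have := (s ⟨0, hr⟩).isLt
        omega
      · have e2 : ρ (j + 1) = 1 := by
          rw [show j + 1 = 2 * r + δ by omega]
          exact hlast
        omega
  have hanti : ∀ a b, a ≤ b → b < n → ρ b + b ≤ ρ a + a := by
    intro a b hab
    induction b, hab using Nat.le_induction with
    | base => intro _; exact le_rfl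
    | succ b _ ih =>
      intro hb
      have := hstep b hb
      have := ih (by omega)
      omega
  have hlow : ∀ a, a < n → n ≤ ρ a + a := by
    intro a ha
    have := hanti a (2 * r + δ) (by omega) (by omega)
    omega
  have hhigh : ∀ a, a < n → ρ a + a ≤ m + n := by
    intro a ha
    refine (hanti 0 a (by omega) ha).trans ?_
    rcases row_cases hn ⟨0, by omega⟩ with ⟨i, hi⟩ | ⟨i, hi⟩ | hi | hi
    · simp only at hi
      have := heven i
      rw [← hi] at this
      have := (s i).isLt
      omega
    · simp only at hi
      omega
    · simp only at hi
      rw [← hi] at hlast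
      omega
    · simp only at hi
      rw [htop 0 hi, Nat.add_zero]
  refine ⟨fun j => ⟨ρ j + j - n, by have := hhigh j j.isLt; omega⟩, ⟨?_, ?_, ?_, ?_⟩, ?_⟩
  · intro a b hab
    have := hanti a b hab b.isLt
    simp only
    omega
  · intro a b ha hb
    obtain ⟨i, hi⟩ : ∃ i : Fin r, (a : ℕ) = 2 * i + δ :=
      ⟨⟨(a - δ) / 2, by have := b.isLt; omega⟩, by simp only; omega⟩
    have e1 := heven i
    have e2 := hodd i
    rw [← hi] at e1
    rw [show 2 * (i : ℕ) + 1 + δ = b by omega] at e2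
    simp only
    omega
  · intro a ha
    rw [show 2 * r + δ = a by omega] at hlast
    simp only
    omega
  · intro a ha
    have := htop a ha
    simp only
    omega
  · funext i
    apply Fin.ext
    have e1 := heven i
    have := hlow (2 * i + δ) (by omega)
    simp only [pairedRows]
    omega

lemma sum_strictAnti_svDet_extRows {r δ n m : ℕ} (hδ : δ ≤ 1) (hn : n = 2 * r + 1 + δ)
    (x : Fin n → K) :
    ∑ s ∈ Finset.univ.filter (StrictAnti : (Fin r → Fin (m + n)) → Prop),
        svDet (fun j : Fin n => extRows δ (m + n) (fun i => (s i : ℕ)) j) x =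
      ∑ lam ∈ Finset.univ.filter (fun lam : Fin n → Fin (m + 1) => IsPaired δ lam),
        svDet (fun j : Fin n => (lam j : ℕ) + n - j) x := by
  symm
  refine Finset.sum_of_injOn (pairedRows hn) ?_ ?_ ?_ ?_
  · intro a ha b hb hab
    simp only [Finset.coe_filter, Finset.mem_univ, true_and, Set.mem_ofPred_eq] at ha hb
    funext j
    apply Fin.ext
    have h1 := extRows_pairedRows hδ hn ha j
    have h2 := extRows_pairedRows hδ hn hb j
    rw [hab] at h1
    omega
  · intro a ha
    simp only [Finset.coe_filter, Finset.mem_univ, true_and, Set.mem_ofPred_eq] at ha ⊢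
    exact strictAnti_pairedRows hn ha
  · intro s hs hs'
    simp only [Finset.mem_filter, Finset.mem_univ, true_and] at hs
    by_contra hne
    obtain ⟨lam, h1, h2⟩ := exists_pairedRows_eq hδ hn x hs hne
    exact hs' ⟨lam, by simpa using h1, h2⟩
  · intro lam hlam
    simp only [Finset.mem_filter, Finset.mem_univ, true_and] at hlam
    congr 1
    funext j
    exact (extRows_pairedRows hδ hn hlam j).symm

lemma sum_svDet_extRows {r δ n m : ℕ} (hδ : δ ≤ 1) (hn : n = 2 * r + 1 + δ) (x : Fin n → K) :
    ∑ s : Fin r → Fin (m + n), svDet (fun j : Fin n => extRows δ (m + n) (fun i => (s i : ℕ)) j) x =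
      (r.factorial : K) *
        ∑ lam ∈ Finset.univ.filter (fun lam : Fin n → Fin (m + 1) => IsPaired δ lam),
          svDet (fun j : Fin n => (lam j : ℕ) + n - j) x := by
  rw [← sum_strictAnti_svDet_extRows hδ hn x]
  refine sum_eq_factorial_mul_sum_strictAnti
    (fun s : Fin r → Fin (m + n) => svDet (fun j : Fin n => extRows δ (m + n) (fun i => (s i : ℕ)) j) x) ?_ ?_
  · intro s σ
    exact svDet_extRows_perm hδ hn (fun i => (s i : ℕ)) σ x
  · intro s hs
    obtain ⟨a, b, hab, hne⟩ := Function.not_injective_iff.mp hs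
    refine svDet_eq_zero_of_eq x (i := ⟨2 * a + δ, by omega⟩) (j := ⟨2 * b + δ, by omega⟩) ?_ ?_
    · intro h
      have := congrArg Fin.val h
      simp only at this
      exact hne (Fin.ext (by omega))
    · simp only
      rw [extRows_even _ a rfl, extRows_even _ b rfl, hab]

end PairedShapes

section ColumnParity

lemma lt_card_filter_iff {n m : ℕ} {lam : Fin n → Fin (m + 1)} (h : Antitone fun i => (lam i : ℕ))
    (c : ℕ) (j : Fin n) :
    (j : ℕ) < (Finset.univ.filter fun i : Fin n => c ≤ (lam i : ℕ)).card ↔ c ≤ (lam j : ℕ) :=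
  Tuple.lt_card_ge_iff_apply_ge_of_antitone (f := fun i => (lam i : ℕ)) (a := c) (j := j) h

lemma column_parity_iff_isPaired {n m δ : ℕ} (hδ : δ ≤ 1) (hn₁ : 1 ≤ n) (hn : (n + δ) % 2 = 1) (hm : 0 < m)
    (lam : Fin n → Fin (m + 1)) :
    ((Antitone fun i => (lam i : ℕ)) ∧ ∀ c : ℕ, 1 ≤ c → c ≤ m →
      (Finset.univ.filter (fun j : Fin n => c ≤ (lam j : ℕ))).card % 2 = δ) ↔
    IsPaired δ lam := by
  constructor
  · rintro ⟨h1, h2⟩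
    refine ⟨h1, ?_, ?_, ?_⟩
    · intro i j hi hj
      refine le_antisymm ?_ (h1 (show i ≤ j from Fin.le_def.mpr (by omega)))
      by_contra hlt
      push Not at hlt
      have := (lam i).isLt
      have hc := h2 (lam i) (by omega) (by omega)
      have e1 := (lt_card_filter_iff h1 (lam i : ℕ) i).mpr le_rfl
      have e2 := (lt_card_filter_iff h1 (lam i : ℕ) j).not.mpr (by omega)
      omega
    · intro i hi
      by_contra h0
      have hc := h2 1 le_rfl hm
      have e1 := (lt_card_filter_iff h1 1 i).mpr (by omega)
      have e2 := Finset.card_le_univ (Finset.univ.filter fun j : Fin n => 1 ≤ (lam j : ℕ))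
      rw [Fintype.card_fin] at e2
      omega
    · intro i hi
      by_contra h0
      have := (lam i).isLt
      have hc := h2 m hm le_rfl
      have e1 := (lt_card_filter_iff h1 m i).not.mpr (by omega)
      omega
  · rintro ⟨h1, h2, h3, h4⟩
    refine ⟨h1, fun c hc hcm => ?_⟩
    set k := (Finset.univ.filter fun j : Fin n => c ≤ (lam j : ℕ)).card with hk
    by_contra hkδ
    have e2 : k ≤ n := by
      have := Finset.card_le_univ (Finset.univ.filter fun j : Fin n => c ≤ (lam j : ℕ))
      rwa [Fintype.card_fin] at this
    rcases Nat.eq_zero_or_pos k with h0 | h0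
    · have hn0 : 0 < n := by omega
      have := (lt_card_filter_iff h1 c ⟨0, hn0⟩).not.mp (by rw [← hk]; simp only; omega)
      have := h4 ⟨0, hn0⟩ (by simp only; omega)
      omega
    have a1 := (lt_card_filter_iff h1 c ⟨k - 1, by omega⟩).mp (by rw [← hk]; simp only; omega)
    by_cases hkn : k = n
    · have := h3 ⟨k - 1, by omega⟩ (by simp only; omega)
      omega
    · have a2 := (lt_card_filter_iff h1 c ⟨k, by omega⟩).not.mp (by rw [← hk]; simp only; omega)
      by_cases hk1 : (k - 1) % 2 = δ
      · have := h2 ⟨k - 1, by omega⟩ ⟨k, by omega⟩ hk1 (by simp only; omega)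
        omega
      · omega

lemma isPaired_zero_box {n δ : ℕ} (lam : Fin n → Fin (0 + 1)) : IsPaired δ lam := by
  have h : ∀ i, (lam i : ℕ) = 0 := fun i => by have := (lam i).isLt; omega
  exact ⟨fun i j _ => by simp, fun i j _ _ => by simp, fun i _ => h i, fun i _ => h i⟩

end ColumnParity

section Specialization

variable {K : Type*} [Field K]

lemma zpow_sub_zpow_neg (z : K) (k : ℤ) (l : ℕ) (h : k = l) : z ^ k - z ^ (-k) = sv l z := by
  rw [h, sv, _root_.zpow_neg, zpow_natCast, inv_pow]

lemma spP_eq_svDet_div {n : ℕ} (z : Fin n → K) (lam : Fin n → ℕ) :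
    spP z (fun i => (lam i : ℤ)) =
      svDet (fun j : Fin n => lam j + n - j) z / svDet (fun j : Fin n => n - j) z := by
  unfold spP svDet
  congr 2
  · ext i j
    exact zpow_sub_zpow_neg _ _ _ (by have := i.isLt; beta_reduce; omega)
  · ext i j
    exact zpow_sub_zpow_neg _ _ _ (by have := i.isLt; beta_reduce; omega)

end Specialization

section Denominator

variable {K : Type*} [Field K]

open Polynomial in
lemma exists_monic_sv (l : ℕ) : ∃ p q : K[X], (p.Monic ∧ p.natDegree = l) ∧
    (q.Monic ∧ q.natDegree = l + 1) ∧ ∀ x : K, x ≠ 0 →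
      sv (l + 1) x = (x - x⁻¹) * p.eval (yv x) ∧ sv (l + 2) x = (x - x⁻¹) * q.eval (yv x) := by
  induction l with
  | zero =>
    refine ⟨1, X, ⟨monic_one, natDegree_one⟩, ⟨monic_X, natDegree_X⟩, fun x _ => ⟨?_, ?_⟩⟩
    · simp [sv]
    · simp only [sv, yv, eval_X]
      ring
  | succ l ih =>
    obtain ⟨p, q, ⟨hp, hpd⟩, ⟨hq, hqd⟩, h⟩ := ih
    have hXq : (X * q).natDegree = l + 2 := by
      rw [monic_X.natDegree_mul hq, natDegree_X, hqd]
      ring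
    have hlt : p.natDegree < (X * q).natDegree := by omega
    refine ⟨q, X * q - p, ⟨hq, hqd⟩, ⟨?_, ?_⟩, fun x hx => ⟨(h x hx).2, ?_⟩⟩
    · exact (monic_X.mul hq).sub_of_left (degree_lt_degree hlt)
    · rw [natDegree_sub_eq_left_of_natDegree_lt hlt, hXq]
    · obtain ⟨h1, h2⟩ := h x hx
      have h3 : sv (l + 1 + 2) x = yv x * sv (l + 2) x - sv (l + 1) x := by
        simp only [sv, yv, pow_succ]
        field_simp
        ring
      rw [h3, h1, h2, eval_sub, eval_mul, eval_X]
      ring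

lemma svDet_succ {n : ℕ} {x : Fin n → K} (hx : ∀ i, x i ≠ 0) :
    svDet (fun i : Fin n => (i : ℕ) + 1) x = (∏ i, (x i - (x i)⁻¹)) * yvDet x := by
  choose p q hp hq h using fun l => exists_monic_sv (K := K) l
  unfold svDet yvDet
  rw [Matrix.det_eval_matrixOfPolynomials_eq_det_vandermonde _ (fun i : Fin n => p i)
    (fun i => (hp i).2) (fun i => (hp i).1), ← Matrix.det_transpose (Matrix.of fun i j => _),
    ← Matrix.det_mul_column]
  congr 1
  ext i j
  exact (h j (x i) (hx i)).1

lemma svDet_sub_ne_zero {n : ℕ} {x : Fin n → K} (hx : ∀ i, x i ≠ 0)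
    (hx' : ∀ i, x i * x i ≠ 1) (hy : yvDet x ≠ 0) : svDet (fun j : Fin n => n - (j : ℕ)) x ≠ 0 := by
  have h := svDet_perm Fin.revPerm (fun i : Fin n => (i : ℕ) + 1) x
  have e : (fun j : Fin n => n - (j : ℕ)) = fun i : Fin n => ((Fin.revPerm i : Fin n) : ℕ) + 1 := by
    funext j
    simp only [Fin.revPerm_apply, Fin.val_rev]
    omega
  rw [e, h, svDet_succ hx]
  refine mul_ne_zero (intUnit_ne_zero _) (mul_ne_zero (Finset.prod_ne_zero_iff.mpr ?_) hy)
  intro i _ h0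
  apply hx' i
  have := hx i
  field_simp at h0
  linear_combination h0

end Denominator

section Generic

variable {K : Type*} [Field K]

lemma yv_eq_yv {a b : K} (ha : a ≠ 0) (hb : b ≠ 0) (h : yv a = yv b) : a = b ∨ a * b = 1 := by
  unfold yv at h
  have : (a - b) * (a * b - 1) = 0 := by
    field_simp at h
    linear_combination h
  rcases mul_eq_zero.mp this with h | h
  · exact Or.inl (sub_eq_zero.mp h)
  · exact Or.inr (sub_eq_zero.mp h)

lemma gen_injective (n : ℕ) : Function.Injective (gen n) :=
  (IsFractionRing.injective (MvPolynomial (Fin n) ℚ) (FF n)).comp (MvPolynomial.X_injective)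

lemma gen_ne_zero (n : ℕ) (i : Fin n) : gen n i ≠ 0 := by
  unfold gen
  rw [Ne, IsFractionRing.to_map_eq_zero_iff]
  exact MvPolynomial.X_ne_zero i

lemma gen_mul_gen_ne_one (n : ℕ) (i j : Fin n) : gen n i * gen n j ≠ 1 := by
  unfold gen
  rw [← map_mul, ← map_one (algebraMap (MvPolynomial (Fin n) ℚ) (FF n))]
  intro h
  have := congrArg (MvPolynomial.eval fun _ => (0 : ℚ))
    (IsFractionRing.injective (MvPolynomial (Fin n) ℚ) (FF n) h)
  simp at this

lemma injective_yv_gen (n : ℕ) : Function.Injective fun i => yv (gen n i) := by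
  intro i j h
  rcases yv_eq_yv (gen_ne_zero n i) (gen_ne_zero n j) h with h | h
  · exact gen_injective n h
  · exact absurd h (gen_mul_gen_ne_one n i j)

end Generic

section Assembly

variable {K : Type*} [Field K]

lemma schurP_zpts {n : ℕ} (m : ℕ) (x : Fin n → K) :
    schurP (zpts x) (fun j => if (j : ℕ) < n - 1 then (m : ℤ) else 0) =
      rectNum n m x / rectNum n 0 x := by
  unfold schurP rectNum
  congr 2
  ext i j
  simp [rectExp]

lemma rectNum_div_eq_sum_spP [CharZero K] {r δ n : ℕ} (hδ : δ ≤ 1) (hn : n = 2 * r + 1 + δ)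
    {x : Fin n → K} (hD : svDet (fun j : Fin n => n - (j : ℕ)) x ≠ 0) (hy : yvDet x ≠ 0)
    {t c : K} (hc : c ≠ 0) (h : ∀ m, t * rectNum n m x = c * yvDet x *
      ∑ s : Fin r → Fin (m + n), svDet (fun j : Fin n => extRows δ (m + n) (fun i => (s i : ℕ)) j) x)
    (m : ℕ) :
    rectNum n m x / rectNum n 0 x =
      ∑ lam ∈ Finset.univ.filter (fun lam : Fin n → Fin (m + 1) => IsPaired δ lam),
        spP x (fun i => ((lam i : ℕ) : ℤ)) := by
  have hr : (r.factorial : K) ≠ 0 := by exact_mod_cast r.factorial_ne_zero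
  have hm := h m
  have h0 := h 0
  rw [sum_svDet_extRows hδ hn] at hm h0
  have hsum : ∑ lam ∈ Finset.univ.filter (fun lam : Fin n → Fin (0 + 1) => IsPaired δ lam),
      svDet (fun j : Fin n => (lam j : ℕ) + n - j) x = svDet (fun j : Fin n => n - (j : ℕ)) x := by
    rw [Finset.filter_true_of_mem fun lam _ => isPaired_zero_box lam]
    simp
  rw [hsum] at h0
  have hne : t * rectNum n 0 x ≠ 0 := by
    rw [h0]
    exact mul_ne_zero (mul_ne_zero hc hy) (mul_ne_zero hr hD)
  have ht := left_ne_zero_of_mul hne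
  simp_rw [spP_eq_svDet_div]
  rw [← Finset.sum_div, ← mul_div_mul_left _ _ ht, hm, h0,
    mul_div_mul_left _ _ (mul_ne_zero hc hy), mul_div_mul_left _ _ hr]

end Assembly

/-- **Corollary.**  For `n ≥ 1` and a positive integer `m`, the Schur function of rectangular
shape `(m^{n-1})` in the `2n` variables `(x_1, x_1^{-1}, …, x_n, x_n^{-1})` equals the sum of
the symplectic characters `sp_λ(x_1,…,x_n)` over all partitions `λ ⊆ (m^n)` all of whose column
lengths are odd if `n` is even, and over all those all of whose column lengths are even if `n`
is odd; an identity in `ℚ(x_1, …, x_n)`.  Here `gen n i` plays the role of `x_i`, and the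
column length `λ′_c` is the number of indices `j` with `λ_j ≥ c`. -/
theorem schur_rectangle'_eq_sum_sp_columns (n m : ℕ) (hn : 1 ≤ n) (hm : 0 < m) :
    schurP
      (fun j : Fin (2 * n) =>
        if (j : ℕ) % 2 = 0 then gen n ⟨(j : ℕ) / 2, by have := j.isLt; omega⟩
        else (gen n ⟨(j : ℕ) / 2, by have := j.isLt; omega⟩)⁻¹)
      (fun j => if (j : ℕ) < n - 1 then (m : ℤ) else 0) =
    if Even n then
      ∑ lam ∈ Finset.univ.filter
          (fun lam : Fin n → Fin (m + 1) =>
            (Antitone fun i => (lam i : ℕ)) ∧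
            ∀ c : ℕ, 1 ≤ c → c ≤ m →
              Odd (Finset.univ.filter (fun j : Fin n => c ≤ (lam j : ℕ))).card),
        spP (gen n) (fun i => ((lam i : ℕ) : ℤ))
    else
      ∑ lam ∈ Finset.univ.filter
          (fun lam : Fin n → Fin (m + 1) =>
            (Antitone fun i => (lam i : ℕ)) ∧
            ∀ c : ℕ, 1 ≤ c → c ≤ m →
              Even (Finset.univ.filter (fun j : Fin n => c ≤ (lam j : ℕ))).card),
        spP (gen n) (fun i => ((lam i : ℕ) : ℤ)) := by
  have hx := gen_ne_zero n
  have hinj := injective_yv_gen n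
  have hy := yvDet_ne_zero hinj
  have hD := svDet_sub_ne_zero hx (fun i => gen_mul_gen_ne_one n i i) hy
  refine (schurP_zpts m (gen n)).trans ?_
  split_ifs with he
  · obtain ⟨r, rfl⟩ : ∃ r, n = 2 * r + 2 := ⟨n / 2 - 1, by have := Nat.even_iff.mp he; omega⟩
    obtain ⟨t, c, hc, h⟩ := exists_rectNum_eq_pairSumTop (K := FF (2 * r + 2)) r
    rw [rectNum_div_eq_sum_spP (r := r) le_rfl (by ring) hD hy (t := t) hc (fun m => by
      rw [h m (gen _) hx hinj]
      simp_rw [pairSumTop, cons_snoc_pairRows]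
      rfl) m]
    refine Finset.sum_congr (Finset.filter_congr fun lam _ => ?_) fun _ _ => rfl
    simp_rw [← column_parity_iff_isPaired le_rfl hn (by omega) hm, Nat.odd_iff]
  · obtain ⟨r, rfl⟩ : ∃ r, n = 2 * r + 1 := ⟨n / 2, by have := Nat.not_even_iff.mp he; omega⟩
    obtain ⟨t, c, hc, h⟩ := exists_rectNum_eq_pairSumOne (K := FF (2 * r + 1)) r
    rw [rectNum_div_eq_sum_spP (r := r) (δ := 0) zero_le_one (by ring) hD hy (t := t) hc (fun m => by
      rw [h m (gen _) hx hinj]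
      simp_rw [pairSumOne, snoc_pairRows (m + 2 * r + 1)]
      rfl) m]
    refine Finset.sum_congr (Finset.filter_congr fun lam _ => ?_) fun _ _ => rfl
    simp_rw [← column_parity_iff_isPaired zero_le_one hn (by omega) hm, Nat.even_iff]
end
end

section
/- Let n ≥ 1 and let m be a positive integer. Then, as an identity of rational functions in ℚ(x_1^{1/2},…,x_n^{1/2}), the sum of the Schur polynomials s_{(m^n)} and s_{(m^{n−1})}, both evaluated at the 2n−1 variables (x_1, x_1^{−1}, …, x_{n−1}, x_{n−1}^{−1}, x_n), equals so^D_{((m/2)^n)}(x_1,…,x_n) · sp_{((m/2)^{n−1})}(x_1,…,x_{n−1}) · x_n^{m/2}. -/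
open Matrix BigOperators
open scoped Classical

noncomputable section

variable {F : Type*} [Field F]

/-- Symplectic character `sp_λ(x_1, …, x_N)`, in "doubled" form: `z i` represents
`x_i^{1/2}` and `μ i` represents `2·λ_i` (so half-integer weights are allowed). -/
def spD {N : ℕ} (z : Fin N → F) (μ : Fin N → ℤ) : F :=
  Matrix.det (Matrix.of fun i j : Fin N =>
      z j ^ (μ i + 2 * ((N : ℤ) - (i : ℕ))) - z j ^ (-(μ i + 2 * ((N : ℤ) - (i : ℕ))))) /
  Matrix.det (Matrix.of fun i j : Fin N =>
      z j ^ (2 * ((N : ℤ) - (i : ℕ))) - z j ^ (-(2 * ((N : ℤ) - (i : ℕ)))))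

/-- Odd orthogonal character `so^B_λ(x_1, …, x_N)`, in "doubled" form: `z i` represents
`x_i^{1/2}` and `μ i` represents `2·λ_i`. -/
def soBD {N : ℕ} (z : Fin N → F) (μ : Fin N → ℤ) : F :=
  Matrix.det (Matrix.of fun i j : Fin N =>
      z j ^ (μ i + 2 * ((N : ℤ) - (i : ℕ)) - 1) -
        z j ^ (-(μ i + 2 * ((N : ℤ) - (i : ℕ)) - 1))) /
  Matrix.det (Matrix.of fun i j : Fin N =>
      z j ^ (2 * ((N : ℤ) - (i : ℕ)) - 1) - z j ^ (-(2 * ((N : ℤ) - (i : ℕ)) - 1)))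

/-- Even orthogonal character `so^D_λ(x_1, …, x_N)`, in "doubled" form: `z i` represents
`x_i^{1/2}` and `μ i` represents `2·λ_i`; the factor is `2` if `λ_N > 0` and `1` otherwise. -/
def soDD {N : ℕ} (z : Fin N → F) (μ : Fin N → ℤ) : F :=
  (if h : 0 < N then (if 0 < μ ⟨N - 1, Nat.sub_lt h Nat.one_pos⟩ then (2 : F) else 1) else 1) *
  (Matrix.det (Matrix.of fun i j : Fin N =>
      z j ^ (μ i + 2 * ((N : ℤ) - 1 - (i : ℕ))) +
        z j ^ (-(μ i + 2 * ((N : ℤ) - 1 - (i : ℕ))))) /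
   Matrix.det (Matrix.of fun i j : Fin N =>
      z j ^ (2 * ((N : ℤ) - 1 - (i : ℕ))) + z j ^ (-(2 * ((N : ℤ) - 1 - (i : ℕ))))))

/-- The matrix `Ā_λ` of the bialternant formula for the intermediate symplectic character
`sp^{(k, N-k)}`, in "doubled" form: `z i` represents `x_i^{1/2}`, `μ i` represents `2·λ_i`. -/
def interMatD {N : ℕ} (k : ℕ) (z : Fin N → F) (μ : Fin N → ℤ) : Matrix (Fin N) (Fin N) F :=
  Matrix.of fun i j : Fin N =>
    if (j : ℕ) < k then
      z j ^ (μ i + 2 * ((k : ℤ) - (i : ℕ))) /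
          ∏ l ∈ Finset.univ.filter (fun l : Fin N => k ≤ (l : ℕ)), (1 - (z j ^ 2)⁻¹ * z l ^ 2) -
        z j ^ (-(μ i + 2 * ((k : ℤ) - (i : ℕ)))) /
          ∏ l ∈ Finset.univ.filter (fun l : Fin N => k ≤ (l : ℕ)), (1 - z j ^ 2 * z l ^ 2)
    else z j ^ (μ i + 2 * ((N : ℤ) - 1 - (i : ℕ)))

/-- Intermediate symplectic character `sp^{(k, N-k)}_λ(x_1, …, x_k | x_{k+1}, …, x_N)`, in
"doubled" form: `z i` represents `x_i^{1/2}` and `μ i` represents `2·λ_i`. -/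
def spInterD {N : ℕ} (k : ℕ) (z : Fin N → F) (μ : Fin N → ℤ) : F :=
  (interMatD k z μ).det / (interMatD k z fun _ => 0).det

/-- Rows and columns may be reindexed by two different equivalences at the cost of a sign. -/
theorem det_submatrix_equiv_equiv {ι κ : Type*} [Fintype ι] [DecidableEq ι] [Fintype κ]
    [DecidableEq κ] (e f : ι ≃ κ) :
    ∃ c : F, c ≠ 0 ∧ ∀ M : Matrix κ κ F, M.det = c * (M.submatrix e f).det := by
  refine ⟨((Equiv.Perm.sign (e.symm.trans f) : ℤ) : F), ?_, fun M => ?_⟩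
  · rcases Int.units_eq_one_or (Equiv.Perm.sign (e.symm.trans f)) with h | h <;> simp [h]
  · have h : M.submatrix e f = (M.submatrix id (e.symm.trans f)).submatrix e e := by
      ext i j
      simp
    rw [h, Matrix.det_submatrix_equiv_self, Matrix.det_permute', ← mul_assoc]
    rcases Int.units_eq_one_or (Equiv.Perm.sign (e.symm.trans f)) with h | h <;> simp [h]

/-- Numbering of the rows of the alternant: the upper half increasingly, then the lower half
decreasingly. -/
def rowEquiv {p N : ℕ} (hN : N = 2 * p + 1) : Fin (p + 1) ⊕ Fin p ≃ Fin N :=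
  Equiv.ofBijective
    (Sum.elim (fun i => ⟨i, by omega⟩) fun i => ⟨2 * p - i, by omega⟩) <| by
    rw [Fintype.bijective_iff_injective_and_card]
    refine ⟨?_, by simp; omega⟩
    rintro (⟨i, hi⟩ | ⟨i, hi⟩) (⟨j, hj⟩ | ⟨j, hj⟩) h <;>
      simp only [Sum.elim_inl, Sum.elim_inr, Fin.mk.injEq, Sum.inl.injEq, Sum.inr.injEq,
        reduceCtorEq] at h ⊢ <;> omega

/-- Numbering of the columns of the alternant: the even ones, then the odd ones. -/
def colEquiv {p N : ℕ} (hN : N = 2 * p + 1) : Fin (p + 1) ⊕ Fin p ≃ Fin N :=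
  Equiv.ofBijective
    (Sum.elim (fun i => ⟨2 * i, by omega⟩) fun i => ⟨2 * i + 1, by omega⟩) <| by
    rw [Fintype.bijective_iff_injective_and_card]
    refine ⟨?_, by simp; omega⟩
    rintro (⟨i, hi⟩ | ⟨i, hi⟩) (⟨j, hj⟩ | ⟨j, hj⟩) h <;>
      simp only [Sum.elim_inl, Sum.elim_inr, Fin.mk.injEq, Sum.inl.injEq, Sum.inr.injEq,
        reduceCtorEq] at h ⊢ <;> omega

/-- The even block, the numerator of an even orthogonal character. -/
def evenBlock {p : ℕ} (z : Fin (p + 1) → F) (m : ℤ) : Matrix (Fin (p + 1)) (Fin (p + 1)) F :=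
  Matrix.of fun i j => z j ^ (m + 2 * ((p : ℤ) - (i : ℕ))) + z j ^ (-(m + 2 * ((p : ℤ) - (i : ℕ))))

/-- The odd block, the numerator of a symplectic character. -/
def oddBlock {p : ℕ} (z : Fin (p + 1) → F) (m : ℤ) : Matrix (Fin p) (Fin p) F :=
  Matrix.of fun i j => z j.castSucc ^ (m + 2 * ((p : ℤ) - (i : ℕ))) -
    z j.castSucc ^ (-(m + 2 * ((p : ℤ) - (i : ℕ))))

/-- The upper rows of the symmetrized alternant, in the variables `w`. -/
def upperBlock (p : ℕ) {q : ℕ} (w : Fin q → F) (m : ℤ) : Matrix (Fin (p + 1)) (Fin q) F :=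
  Matrix.of fun i j => w j ^ (m + 2 * ((p : ℤ) - (i : ℕ))) +
    if (i : ℕ) = p then w j ^ (-m) else 0

/-- The lower rows of the symmetrized alternant, in the variables `w`. -/
def lowerBlock (p : ℕ) {q : ℕ} (w : Fin q → F) (m : ℤ) : Matrix (Fin p) (Fin q) F :=
  Matrix.of fun i j => w j ^ (-(m + 2 * ((p : ℤ) - (i : ℕ))))

/-- The inclusion of the first `p` coordinates. -/
def inclMatrix (F : Type*) [Field F] (p : ℕ) : Matrix (Fin (p + 1)) (Fin p) F :=
  (1 : Matrix (Fin (p + 1)) (Fin (p + 1)) F).submatrix id Fin.castSucc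

theorem transpose_inclMatrix_mul {p q : ℕ} (M : Matrix (Fin (p + 1)) (Fin q) F) :
    (inclMatrix F p)ᵀ * M = M.submatrix Fin.castSucc id := by
  ext i j
  simp [inclMatrix, Matrix.mul_apply, Matrix.one_apply]

theorem mul_inclMatrix {p q : ℕ} (M : Matrix (Fin q) (Fin (p + 1)) F) :
    M * inclMatrix F p = M.submatrix id Fin.castSucc := by
  ext i j
  simp [inclMatrix, Matrix.mul_apply, Matrix.one_apply]

theorem upperBlock_add {p q : ℕ} (w : Fin q → F) (m : ℤ) :
    upperBlock p w m + inclMatrix F p * lowerBlock p w m =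
      Matrix.of fun (i : Fin (p + 1)) (j : Fin q) => w j ^ (m + 2 * ((p : ℤ) - (i : ℕ))) +
        w j ^ (-(m + 2 * ((p : ℤ) - (i : ℕ)))) := by
  ext i j
  induction i using Fin.lastCases with
  | last =>
    simp [upperBlock, inclMatrix, Matrix.mul_apply, Fin.ext_iff,
      (Fin.is_lt _).ne']
  | cast i =>
    simp [upperBlock, lowerBlock, inclMatrix, Matrix.mul_apply, Matrix.one_apply, i.isLt.ne]

theorem det_fromBlocks_upper_lower (h2 : (2 : F) ≠ 0) {p : ℕ} (z : Fin (p + 1) → F) (m : ℤ) :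
    (Matrix.fromBlocks (upperBlock p z m) (upperBlock p (fun j : Fin p => (z j.castSucc)⁻¹) m)
      (lowerBlock p z m) (lowerBlock p (fun j : Fin p => (z j.castSucc)⁻¹) m)).det =
      (evenBlock z m).det * (oddBlock z m).det := by
  set w : Fin p → F := fun j => (z j.castSucc)⁻¹ with hw
  set U := inclMatrix F p
  have hUU : Uᵀ * U = 1 := by
    rw [transpose_inclMatrix_mul]
    ext i j
    simp [U, inclMatrix, Matrix.one_apply]
  have hL : (Matrix.fromBlocks 1 U Uᵀ (-1 : Matrix (Fin p) (Fin p) F)).det = (-2) ^ p := by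
    rw [Matrix.det_fromBlocks_one₁₁, hUU]
    have : (-1 - 1 : Matrix (Fin p) (Fin p) F) = (-2 : F) • 1 := by
      rw [neg_smul, two_smul]; abel
    rw [this, Matrix.det_smul]
    simp
  have hR : (Matrix.fromBlocks 1 (-U) 0 (1 : Matrix (Fin p) (Fin p) F)).det = 1 := by
    simp
  have hK : Matrix.fromBlocks 1 U Uᵀ (-1 : Matrix (Fin p) (Fin p) F) *
      Matrix.fromBlocks (upperBlock p z m) (upperBlock p w m) (lowerBlock p z m) (lowerBlock p w m) *
      Matrix.fromBlocks 1 (-U) 0 (1 : Matrix (Fin p) (Fin p) F) =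
      Matrix.fromBlocks (evenBlock z m) 0
        (Uᵀ * upperBlock p z m - lowerBlock p z m) ((-2 : F) • oddBlock z m) := by
    rw [Matrix.fromBlocks_multiply, Matrix.fromBlocks_multiply]
    simp only [Matrix.one_mul, Matrix.mul_one, Matrix.mul_zero, add_zero, Matrix.mul_neg,
      Matrix.neg_mul, ← sub_eq_add_neg]
    rw [upperBlock_add, upperBlock_add, mul_inclMatrix, mul_inclMatrix,
      transpose_inclMatrix_mul, transpose_inclMatrix_mul]
    congr 1
    · ext i j
      simp [hw, _root_.inv_zpow']
      ring
    · ext i j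
      simp [hw, upperBlock, lowerBlock, oddBlock, i.isLt.ne, _root_.inv_zpow']
      ring
  have := congrArg Matrix.det hK
  rw [Matrix.det_mul, Matrix.det_mul, hL, hR, Matrix.det_fromBlocks_zero₁₂, Matrix.det_smul,
    Fintype.card_fin, mul_one, mul_left_comm] at this
  exact mul_left_cancel₀ (pow_ne_zero _ (neg_ne_zero.mpr h2)) this

/-- The sum of the alternants of two neighbouring rectangles, in variables closed under inversion
up to the last one, factors into an even and an odd block. -/
theorem exists_det_add_det_eq (h2 : (2 : F) ≠ 0) {p N : ℕ} (hN : N = 2 * p + 1)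
    (z : Fin (p + 1) → F) (hz : ∀ j, z j ≠ 0) (y : Fin N → F)
    (hy0 : ∀ j : Fin (p + 1), y ⟨2 * j, by omega⟩ = z j ^ 2)
    (hy1 : ∀ j : Fin p, y ⟨2 * j + 1, by omega⟩ = (z j.castSucc ^ 2)⁻¹) :
    ∃ c : F, c ≠ 0 ∧ ∀ m : ℤ,
      Matrix.det (Matrix.of fun i j : Fin N =>
        y j ^ ((if (i : ℕ) < p + 1 then m else 0) + (N : ℤ) - 1 - (i : ℕ))) +
      Matrix.det (Matrix.of fun i j : Fin N =>
        y j ^ ((if (i : ℕ) < p then m else 0) + (N : ℤ) - 1 - (i : ℕ))) =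
      c * ((evenBlock z m).det * (oddBlock z m).det * z (Fin.last p) ^ (m + 2 * p)) := by
  obtain ⟨c, hc, hdet⟩ := det_submatrix_equiv_equiv (F := F) (rowEquiv hN) (colEquiv hN)
  refine ⟨c, hc, fun m => ?_⟩
  set A : Matrix (Fin N) (Fin N) F := Matrix.of fun i j : Fin N =>
    y j ^ ((if (i : ℕ) < p + 1 then m else 0) + (N : ℤ) - 1 - (i : ℕ)) with hA
  set B : Matrix (Fin N) (Fin N) F := Matrix.of fun i j : Fin N =>
    y j ^ ((if (i : ℕ) < p then m else 0) + (N : ℤ) - 1 - (i : ℕ)) with hB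
  set r : Fin N := ⟨p, by omega⟩ with hr
  have hBA : B = A.updateRow r (B r) := by
    ext i j
    by_cases hi : i = r
    · simp [hi]
    · have : (i : ℕ) ≠ p := fun h => hi (Fin.ext h)
      have h' : (i : ℕ) < p + 1 ↔ (i : ℕ) < p := by omega
      simp only [Matrix.updateRow_ne hi, hA, hB, Matrix.of_apply, h']
  have hsum : A.det + B.det = (A.updateRow r (A r + B r)).det := by
    rw [Matrix.det_updateRow_add, Matrix.updateRow_eq_self, ← hBA]
  rw [hsum, hdet]
  congr 1
  set w : Fin p → F := fun j => (z j.castSucc)⁻¹ with hw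
  have hM : (A.updateRow r (A r + B r)).submatrix (rowEquiv hN) (colEquiv hN) =
      Matrix.fromBlocks (upperBlock p z m) (upperBlock p w m) (lowerBlock p z m) (lowerBlock p w m) *
        Matrix.diagonal (fun c => Sum.elim z w c ^ (m + 2 * p)) := by
    have hcol : ∀ j, y (colEquiv hN j) = Sum.elim z w j ^ (2 : ℤ) := by
      rintro (j | j)
      · exact_mod_cast hy0 j
      · exact (hy1 j).trans (by simp [hw, zpow_ofNat])
    have hv : ∀ j, Sum.elim z w j ≠ 0 := by
      rintro (j | j) <;> simp [hw, hz]
    have hblk : Matrix.fromBlocks (upperBlock p z m) (upperBlock p w m) (lowerBlock p z m)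
        (lowerBlock p w m) = Matrix.of fun (i : Fin (p + 1) ⊕ Fin p) (j : Fin (p + 1) ⊕ Fin p) =>
        Sum.elim (fun i : Fin (p + 1) => Sum.elim z w j ^ (m + 2 * ((p : ℤ) - (i : ℕ))) +
            if (i : ℕ) = p then Sum.elim z w j ^ (-m) else 0)
          (fun i : Fin p => Sum.elim z w j ^ (-(m + 2 * ((p : ℤ) - (i : ℕ))))) i := by
      ext (i | i) (j | j) <;> simp [upperBlock, lowerBlock]
    rw [hblk]
    ext i j
    rw [Matrix.mul_diagonal, Matrix.submatrix_apply, Matrix.of_apply]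
    rcases i with i | i
    · have hi : rowEquiv hN (Sum.inl i) = ⟨i, by omega⟩ := rfl
      rw [hi, Sum.elim_inl]
      by_cases h : (i : ℕ) = p
      · have : (⟨i, by omega⟩ : Fin N) = r := Fin.ext h
        rw [this, Matrix.updateRow_self]
        simp only [Pi.add_apply, hA, hB, Matrix.of_apply, hr, hcol, ← _root_.zpow_mul, h, if_true,
          lt_irrefl, if_false, Nat.lt_succ_self, add_mul, ← zpow_add₀ (hv j)]
        congr 2 <;> (push_cast [hN]; ring)
      · have : (⟨i, by omega⟩ : Fin N) ≠ r := fun h' => h (Fin.ext_iff.mp h')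
        rw [Matrix.updateRow_ne this]
        simp only [hA, Matrix.of_apply, hcol, ← _root_.zpow_mul, h, i.isLt, if_true, if_false, add_zero,
          ← zpow_add₀ (hv j)]
        congr 1
        push_cast [hN]; ring
    · have hi : rowEquiv hN (Sum.inr i) = ⟨2 * p - i, by omega⟩ := rfl
      have hne : (⟨2 * p - i, by omega⟩ : Fin N) ≠ r := by
        intro h'
        have := Fin.ext_iff.mp h'
        simp only [hr] at this
        omega
      have h1 : ¬ 2 * p - (i : ℕ) < p + 1 := by omega
      rw [hi, Sum.elim_inr, Matrix.updateRow_ne hne]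
      simp only [hA, Matrix.of_apply, hcol, ← _root_.zpow_mul, h1, if_false, ← zpow_add₀ (hv j)]
      congr 1
      rw [Nat.cast_sub (by omega)]
      push_cast [hN]; ring
  have hdiag : ∏ c, Sum.elim z w c ^ (m + 2 * p) = z (Fin.last p) ^ (m + 2 * p) := by
    rw [Fintype.prod_sum_type, Fin.prod_univ_castSucc, mul_right_comm]
    simp only [Sum.elim_inl, Sum.elim_inr]
    rw [← Finset.prod_mul_distrib, Finset.prod_eq_one, one_mul]
    intro j _
    rw [← mul_zpow, hw, mul_inv_cancel₀ (hz _), _root_.one_zpow]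
  rw [hM, Matrix.det_mul, Matrix.det_diagonal, hdiag, det_fromBlocks_upper_lower h2]

/-- **Factorization.**  For `n ≥ 1` and a positive integer `m`, the sum of the Schur functions
of shapes `(m^n)` and `(m^{n-1})` in the `2n-1` variables
`(x_1, x_1^{-1}, …, x_{n-1}, x_{n-1}^{-1}, x_n)` equals
`so^D_{((m/2)^n)}(x_1,…,x_n) · sp_{((m/2)^{n-1})}(x_1,…,x_{n-1}) · x_n^{m/2}`, as an identity
in `ℚ(x_1^{1/2}, …, x_n^{1/2})`.  Here `gen n i` plays the role of `x_i^{1/2}` (so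
`x_i = (gen n i)^2`), and the weights of `soDD` and `spD` are doubled. -/
theorem schur_rectangle_sum_factor_soD_sp' (n m : ℕ) (hn : 1 ≤ n) (hm : 0 < m) :
    schurP
      (fun j : Fin (2 * n - 1) =>
        if (j : ℕ) % 2 = 0 then gen n ⟨(j : ℕ) / 2, by have := j.isLt; omega⟩ ^ 2
        else (gen n ⟨(j : ℕ) / 2, by have := j.isLt; omega⟩ ^ 2)⁻¹)
      (fun j => if (j : ℕ) < n then (m : ℤ) else 0) +
    schurP
      (fun j : Fin (2 * n - 1) =>
        if (j : ℕ) % 2 = 0 then gen n ⟨(j : ℕ) / 2, by have := j.isLt; omega⟩ ^ 2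
        else (gen n ⟨(j : ℕ) / 2, by have := j.isLt; omega⟩ ^ 2)⁻¹)
      (fun j => if (j : ℕ) < n - 1 then (m : ℤ) else 0) =
    soDD (gen n) (fun _ => (m : ℤ)) *
      spD (fun i : Fin (n - 1) => gen n ⟨(i : ℕ), by have := i.isLt; omega⟩)
        (fun _ => (m : ℤ)) *
      gen n ⟨n - 1, by omega⟩ ^ (m : ℤ) := by
  obtain ⟨p, rfl⟩ : ∃ p, n = p + 1 := ⟨n - 1, by omega⟩
  have hz : ∀ j, gen (p + 1) j ≠ 0 := fun j => by
    rw [gen, Ne, FaithfulSMul.algebraMap_eq_zero_iff]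
    exact MvPolynomial.X_ne_zero j
  have h2 : (2 : FF (p + 1)) ≠ 0 := two_ne_zero
  set y : Fin (2 * (p + 1) - 1) → FF (p + 1) := fun j =>
    if (j : ℕ) % 2 = 0 then gen (p + 1) ⟨(j : ℕ) / 2, by have := j.isLt; omega⟩ ^ 2
    else (gen (p + 1) ⟨(j : ℕ) / 2, by have := j.isLt; omega⟩ ^ 2)⁻¹ with hy
  obtain ⟨c, hc, hdet⟩ := exists_det_add_det_eq h2 (p := p) (N := 2 * (p + 1) - 1) (by omega)
    (gen (p + 1)) hz y
    (fun j => by simp [hy])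
    (fun j => by
      have h1 : (2 * (j : ℕ) + 1) % 2 ≠ 0 := by omega
      have h2 : (2 * (j : ℕ) + 1) / 2 = j := by omega
      simp only [hy, h1, if_false, h2]
      rfl)
  have hm' := hdet m
  have h0 := hdet 0
  simp only [ite_self, ← two_mul] at h0
  have hso : soDD (gen (p + 1)) (fun _ => (m : ℤ)) =
      2 * ((evenBlock (gen (p + 1)) m).det / (evenBlock (gen (p + 1)) 0).det) := by
    simp [soDD, evenBlock, hm]
  have hsp : spD (fun i : Fin (p + 1 - 1) => gen (p + 1) ⟨(i : ℕ), by have := i.isLt; omega⟩)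
      (fun _ => (m : ℤ)) =
      (oddBlock (gen (p + 1)) m).det / (oddBlock (gen (p + 1)) 0).det := by
    simp only [spD, oddBlock, zero_add]
    rfl
  rw [hso, hsp]
  simp only [schurP, zero_add, Nat.add_sub_cancel] at h0 hm' ⊢
  rw [← add_div, hm']
  have hD := (eq_div_iff h2).mpr ((mul_comm _ _).trans h0)
  rw [hD, zpow_add₀ (hz _)]
  have hl := zpow_ne_zero (2 * (p : ℤ)) (hz (Fin.last p))
  change _ = _ * gen (p + 1) (Fin.last p) ^ (m : ℤ)
  rw [div_div_eq_mul_div]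
  generalize (evenBlock (gen (p + 1)) 0).det = a
  generalize (oddBlock (gen (p + 1)) 0).det = b
  by_cases ha : a = 0
  · simp [ha]
  by_cases hb : b = 0
  · simp [hb]
  field_simp
end
end
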